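/- Let K be a number field of degree n ≤ 5 over ℚ. There is a finite set S of rational primes such that for every real σ > 19/20 the double series ∑_{p ∉ S} ∑_{i ≥ 2} a^{1,<}_{𝓞_K}(p^i) · p^{−iσ} (sum over primes p not in S and integers i ≥ 2) converges, i.e., is finite. -/

import Mathlib

open NumberField

/-- `a^{1,<}_{𝓞 K}(m)`: the number of orders of the number field `K` (unital subrings
of `𝓞 K` of finite additive index) with additive index exactly `m`. -/
noncomputable def numOrdersOfIndex (K : Type*) [Field K] [NumberField K] (m : ℕ) : ℕ :=
  Nat.card {O : Subring (𝓞 K) // O.toAddSubgroup.index = m}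

namespace OrderCount

section Layers

variable {A : Type*} [CommRing A] (p : ℕ)

/-- The subgroup `pA` of a ring `A`. -/
def multiples (A : Type*) [CommRing A] (p : ℕ) : AddSubgroup A :=
  (AddMonoidHom.mulLeft (p : A)).range

/-- The elements `x` with `p ^ j * x ∈ H`. -/
def level (H : AddSubgroup A) (j : ℕ) : AddSubgroup A :=
  H.comap (AddMonoidHom.mulLeft ((p : A) ^ j))

/-- The elements which modulo `p` lie in `level p H j`. -/
def layer (H : AddSubgroup A) (j : ℕ) : AddSubgroup A :=
  level p H j ⊔ multiples A p

variable {p}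

lemma mem_multiples {x : A} : x ∈ multiples A p ↔ ∃ y, (p : A) * y = x := Iff.rfl

lemma mul_mem_multiples (y : A) : (p : A) * y ∈ multiples A p := ⟨y, rfl⟩

lemma mem_level {H : AddSubgroup A} {j : ℕ} {x : A} :
    x ∈ level p H j ↔ (p : A) ^ j * x ∈ H := Iff.rfl

lemma level_zero (H : AddSubgroup A) : level p H 0 = H := by
  ext x; simp [mem_level]

lemma level_le_layer (H : AddSubgroup A) (j : ℕ) : level p H j ≤ layer p H j := le_sup_left

lemma multiples_le_layer (H : AddSubgroup A) (j : ℕ) : multiples A p ≤ layer p H j :=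
  le_sup_right

lemma level_mono {H H' : AddSubgroup A} (h : H ≤ H') (j : ℕ) : level p H j ≤ level p H' j :=
  fun _ hx => h hx

lemma layer_mono {H H' : AddSubgroup A} (h : H ≤ H') (j : ℕ) : layer p H j ≤ layer p H' j :=
  sup_le_sup_right (level_mono h j) _

lemma mem_layer {H : AddSubgroup A} {j : ℕ} {x : A} :
    x ∈ layer p H j ↔ ∃ y ∈ level p H j, ∃ z, x = y + p * z := by
  rw [layer, AddSubgroup.mem_sup]
  constructor
  · rintro ⟨y, hy, _, ⟨z, rfl⟩, rfl⟩
    exact ⟨y, hy, z, rfl⟩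
  · rintro ⟨y, hy, z, rfl⟩
    exact ⟨y, hy, _, ⟨z, rfl⟩, rfl⟩

lemma level_le_succ (H : AddSubgroup A) (j : ℕ) : level p H j ≤ level p H (j + 1) := by
  intro x hx
  rw [mem_level] at hx ⊢
  have : (p : A) ^ (j + 1) * x = p • ((p : A) ^ j * x) := by rw [nsmul_eq_mul]; ring
  rw [this]
  exact H.nsmul_mem hx p

lemma level_le_level (H : AddSubgroup A) {i j : ℕ} (h : i ≤ j) : level p H i ≤ level p H j :=
  monotone_nat_of_le_succ (level_le_succ H) h

lemma layer_le_layer (H : AddSubgroup A) {i j : ℕ} (h : i ≤ j) : layer p H i ≤ layer p H j :=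
  sup_le_sup_right (level_le_level H h) _

lemma index_level (H : AddSubgroup A) (j : ℕ) :
    (level p H j).index = (layer p H j).index * (level p H (j + 1)).index := by
  rw [← AddSubgroup.relIndex_mul_index (level_le_layer H j), mul_comm]
  congr 1
  rw [layer, AddSubgroup.relIndex_sup_left, multiples, AddMonoidHom.range_eq_map,
    ← AddSubgroup.relIndex_comap, AddSubgroup.relIndex_top_right]
  congr 1
  ext x
  simp only [level, AddSubgroup.mem_comap, AddMonoidHom.coe_mulLeft]
  rw [← mul_assoc, ← pow_succ]

/-- The exponent of the index of `layer p H j`. -/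
noncomputable def codim (p : ℕ) (H : AddSubgroup A) (j : ℕ) : ℕ := Nat.log p (layer p H j).index

lemma index_layer (hp : p.Prime) {n : ℕ} (hA : (multiples A p).index = p ^ n)
    (H : AddSubgroup A) (j : ℕ) : (layer p H j).index = p ^ codim p H j := by
  have h := AddSubgroup.index_dvd_of_le (multiples_le_layer (p := p) H j)
  rw [hA] at h
  obtain ⟨k, -, hk⟩ := (Nat.dvd_prime_pow hp).1 h
  rw [codim, hk, Nat.log_pow hp.one_lt]

lemma codim_anti (H H' : AddSubgroup A) {i j : ℕ} (h : layer p H i ≤ layer p H' j)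
    (hne : (layer p H i).index ≠ 0) : codim p H' j ≤ codim p H i :=
  Nat.log_mono_right (Nat.le_of_dvd (Nat.pos_of_ne_zero hne) (AddSubgroup.index_dvd_of_le h))

lemma eq_of_le_of_index_eq {G : Type*} [AddGroup G] {H K : AddSubgroup G} (h : H ≤ K)
    (he : H.index = K.index) (hne : K.index ≠ 0) : H = K := by
  refine le_antisymm h (AddSubgroup.relIndex_eq_one.1 ?_)
  have := AddSubgroup.relIndex_mul_index h
  rw [he] at this
  exact Nat.eq_of_mul_eq_mul_right (Nat.pos_of_ne_zero hne) (by rw [this, one_mul])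

section Codim

variable (hp : p.Prime) {n : ℕ} (hA : (multiples A p).index = p ^ n)
include hp hA

lemma index_layer_ne_zero (H : AddSubgroup A) (j : ℕ) : (layer p H j).index ≠ 0 := by
  rw [index_layer hp hA]
  exact pow_ne_zero _ hp.ne_zero

lemma codim_le_of_layer_le {H H' : AddSubgroup A} {i j : ℕ} (h : layer p H i ≤ layer p H' j) :
    codim p H' j ≤ codim p H i :=
  codim_anti H H' h (index_layer_ne_zero hp hA H i)

lemma layer_eq_of_codim_le {H H' : AddSubgroup A} {i j : ℕ} (h : layer p H i ≤ layer p H' j)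
    (hc : codim p H i ≤ codim p H' j) : layer p H i = layer p H' j := by
  refine eq_of_le_of_index_eq h ?_ (index_layer_ne_zero hp hA _ _)
  rw [index_layer hp hA, index_layer hp hA, le_antisymm hc (codim_le_of_layer_le hp hA h)]

omit hp hA in
lemma codim_eq_zero {H : AddSubgroup A} {j : ℕ} (h : layer p H j = ⊤) : codim p H j = 0 := by
  rw [codim, h, AddSubgroup.index_top, Nat.log_one_right]

lemma codim_anti_right (H : AddSubgroup A) {i j : ℕ} (h : i ≤ j) :
    codim p H j ≤ codim p H i :=
  codim_le_of_layer_le hp hA (layer_le_layer H h)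

lemma index_level_eq_pow (H : AddSubgroup A) (j k : ℕ) :
    (level p H j).index = p ^ (∑ i ∈ Finset.range k, codim p H (j + i)) *
      (level p H (j + k)).index := by
  induction k with
  | zero => simp
  | succ k ih =>
    rw [ih, index_level, index_layer hp hA, Finset.sum_range_succ, pow_add, mul_assoc, add_assoc]

lemma level_eq_top {H : AddSubgroup A} {N : ℕ} (hN : ∀ x : A, (p : A) ^ N * x ∈ H) {j : ℕ}
    (h : codim p H j = 0) : level p H j = ⊤ := by
  have htop : level p H (j + N) = ⊤ := by
    rw [eq_top_iff, ← (eq_top_iff.2 fun x _ => hN x : level p H N = ⊤)]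
    exact level_le_level H (Nat.le_add_left N j)
  rw [← AddSubgroup.index_eq_one, index_level_eq_pow hp hA H j N, htop, AddSubgroup.index_top,
    Finset.sum_eq_zero, pow_zero, one_mul]
  intro i _
  have := codim_anti_right hp hA H (Nat.le_add_right j i)
  omega

end Codim

section Subring

lemma mul_mem_layer {O : Subring A} {i j : ℕ} {x y : A} (hx : x ∈ layer p O.toAddSubgroup i)
    (hy : y ∈ layer p O.toAddSubgroup j) : x * y ∈ layer p O.toAddSubgroup (i + j) := by
  obtain ⟨x', hx', u, rfl⟩ := mem_layer.1 hx
  obtain ⟨y', hy', v, rfl⟩ := mem_layer.1 hy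
  refine mem_layer.2 ⟨x' * y', ?_, x' * v + u * y' + p * u * v, by ring⟩
  rw [mem_level] at hx' hy' ⊢
  rw [show (p : A) ^ (i + j) * (x' * y') = ((p : A) ^ i * x') * ((p : A) ^ j * y') by ring]
  exact O.mul_mem hx' hy'

lemma one_mem_layer (O : Subring A) (j : ℕ) : 1 ∈ layer p O.toAddSubgroup j :=
  layer_le_layer _ (Nat.zero_le j) (level_le_layer _ _ (by rw [level_zero]; exact O.one_mem))

lemma layer_eq_top_of_succ_le {O : Subring A}
    (hgen : Subring.closure (layer p O.toAddSubgroup 1 : Set A) = ⊤) {j : ℕ}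
    (h : layer p O.toAddSubgroup (j + 1) ≤ layer p O.toAddSubgroup j) :
    layer p O.toAddSubgroup j = ⊤ := by
  have key : ∀ t : A, ∀ w ∈ layer p O.toAddSubgroup j, t * w ∈ layer p O.toAddSubgroup j := by
    intro t
    have ht : t ∈ Subring.closure (layer p O.toAddSubgroup 1 : Set A) := by rw [hgen]; trivial
    induction ht using Subring.closure_induction with
    | mem x hx =>
      intro w hw
      refine h ?_
      rw [add_comm]
      exact mul_mem_layer hx hw
    | zero => intro w _; rw [zero_mul]; exact zero_mem _
    | one => intro w hw; rwa [one_mul]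
    | add x y _ _ hx hy => intro w hw; rw [add_mul]; exact add_mem (hx w hw) (hy w hw)
    | neg x _ hx => intro w hw; rw [neg_mul]; exact neg_mem (hx w hw)
    | mul x y _ _ hx hy => intro w hw; rw [mul_assoc]; exact hx _ (hy w hw)
  rw [eq_top_iff]
  intro t _
  simpa using key t 1 (one_mem_layer O j)

variable (hp : p.Prime) {n : ℕ} (hA : (multiples A p).index = p ^ n)
include hp hA

lemma codim_succ {O : Subring A}
    (hgen : Subring.closure (layer p O.toAddSubgroup 1 : Set A) = ⊤) (i j : ℕ) (hij : i + 1 = j) :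
    codim p O.toAddSubgroup j < codim p O.toAddSubgroup i ∨
      codim p O.toAddSubgroup i = 0 ∧ codim p O.toAddSubgroup j = 0 := by
  subst hij
  have hanti : codim p O.toAddSubgroup (i + 1) ≤ _ :=
    codim_anti_right hp hA O.toAddSubgroup (Nat.le_succ i)
  by_contra! hcon
  have hzero : codim p O.toAddSubgroup i ≠ 0 := by omega
  refine hzero (codim_eq_zero (layer_eq_top_of_succ_le hgen ?_))
  exact (layer_eq_of_codim_le hp hA (layer_le_layer _ (Nat.le_succ i)) hcon.1).ge

lemma codim_zero_lt (hn : n ≠ 0) (O : Subring A) : codim p O.toAddSubgroup 0 < n := by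
  by_contra! hcon
  have h1 : multiples A p = layer p O.toAddSubgroup 0 := by
    refine eq_of_le_of_index_eq (multiples_le_layer _ _) ?_ (index_layer_ne_zero hp hA _ _)
    have hd := AddSubgroup.index_dvd_of_le (multiples_le_layer (p := p) O.toAddSubgroup 0)
    rw [hA, index_layer hp hA] at hd ⊢
    exact le_antisymm (Nat.pow_le_pow_right hp.pos hcon) (Nat.le_of_dvd (pow_pos hp.pos _) hd)
  have h2 := one_mem_layer (p := p) O 0
  rw [← h1] at h2
  obtain ⟨y, hy⟩ := mem_multiples.1 h2
  have : multiples A p = ⊤ := by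
    rw [eq_top_iff]
    intro x _
    exact ⟨y * x, by rw [AddMonoidHom.coe_mulLeft, ← mul_assoc, hy, one_mul]⟩
  rw [this, AddSubgroup.index_top] at hA
  exact (Nat.one_lt_pow hn hp.one_lt).ne hA

end Subring

end Layers

section Tuples

variable {G : Type*} [AddCommGroup G]

/-- Tuples of elements of `M` which generate `M` modulo `V`. -/
def genTuples (V M : AddSubgroup G) (f : ℕ) : Set (Fin f → G) :=
  {x | (∀ i, x i ∈ M) ∧ M ≤ V ⊔ AddSubgroup.closure (Set.range x)}

lemma relIndex_sup_zmultiples {p : ℕ} (hp : p.Prime) {V : AddSubgroup G} {x : G} (hx : x ∉ V)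
    (hpx : p • x ∈ V) : V.relIndex (V ⊔ AddSubgroup.zmultiples x) = p := by
  rw [AddSubgroup.relIndex_sup_left, ← AddSubgroup.range_zmultiplesHom, AddMonoidHom.range_eq_map,
    ← AddSubgroup.relIndex_comap, AddSubgroup.relIndex_top_right]
  have hle : AddSubgroup.zmultiples (p : ℤ) ≤ V.comap (zmultiplesHom G x) := by
    rw [AddSubgroup.zmultiples_le]
    simpa using hpx
  have hd := AddSubgroup.index_dvd_of_le hle
  rw [Int.index_zmultiples, Int.natAbs_natCast] at hd
  refine ((Nat.dvd_prime hp).1 hd).resolve_left fun h => hx ?_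
  rw [AddSubgroup.index_eq_one] at h
  have : (1 : ℤ) ∈ V.comap (zmultiplesHom G x) := by rw [h]; trivial
  simpa using this

variable [Finite G]

lemma card_pow_le_genTuples {p : ℕ} (hp : p.Prime) (f : ℕ) (V M : AddSubgroup G) (hVM : V ≤ M)
    (hpM : ∀ x ∈ M, p • x ∈ V) (hind : V.relIndex M = p ^ f) :
    Nat.card M ^ f ≤ 2 ^ f * Nat.card (genTuples V M f) := by
  induction f generalizing V with
  | zero =>
    rw [pow_zero, AddSubgroup.relIndex_eq_one] at hind
    rw [pow_zero, pow_zero, one_mul, Nat.one_le_iff_ne_zero, ← Nat.pos_iff_ne_zero, Nat.card_pos_iff]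
    exact ⟨⟨⟨Fin.elim0, fun i => i.elim0, hind.trans le_sup_left⟩⟩, inferInstance⟩
  | succ f ih =>
    let W := {x : G // x ∈ M ∧ x ∉ V}
    have hW : Nat.card M ≤ 2 * Nat.card W := by
      have h1 : Nat.card M = Nat.card V + Nat.card W := by
        have e : M ≃ (V ⊕ W) := by
          classical
          exact (Equiv.sumCompl (fun x : M => (x : G) ∈ V)).symm.trans
            (Equiv.sumCongr ((Equiv.subtypeSubtypeEquivSubtype fun {x} hx => hVM hx))
              (Equiv.subtypeSubtypeEquivSubtypeInter (fun x => x ∈ M) (fun x => x ∉ V)))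
        rw [Nat.card_congr e, Nat.card_sum]
      have h2 : Nat.card V * p ^ (f + 1) = Nat.card M := by
        rw [← hind, ← AddSubgroup.relIndex_bot_left, ← AddSubgroup.relIndex_bot_left,
          AddSubgroup.relIndex_mul_relIndex _ _ _ bot_le hVM]
      have h3 : 2 ≤ p ^ (f + 1) := hp.two_le.trans (Nat.le_self_pow (Nat.succ_ne_zero f) p)
      nlinarith [Nat.mul_le_mul_left (Nat.card V) h3]
    have hstep : ∀ x : W, Nat.card M ^ f ≤
        2 ^ f * Nat.card (genTuples (V ⊔ AddSubgroup.zmultiples (x : G)) M f) := by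
      intro x
      have hle : V ⊔ AddSubgroup.zmultiples (x : G) ≤ M :=
        sup_le hVM (AddSubgroup.zmultiples_le.2 x.2.1)
      refine ih _ hle (fun y hy => le_sup_left (a := V) (hpM y hy)) ?_
      have := AddSubgroup.relIndex_mul_relIndex V _ M le_sup_left hle
      rw [relIndex_sup_zmultiples hp x.2.2 (hpM _ x.2.1), hind, pow_succ'] at this
      exact Nat.eq_of_mul_eq_mul_left hp.pos this
    have hinj : Nat.card (Σ x : W, genTuples (V ⊔ AddSubgroup.zmultiples (x : G)) M f) ≤
        Nat.card (genTuples V M (f + 1)) := by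
      refine Nat.card_le_card_of_injective (fun s => ⟨Fin.cons s.1.1 s.2.1, ?_, ?_⟩) ?_
      · refine Fin.cases ?_ fun i => ?_
        · exact s.1.2.1
        · exact s.2.2.1 i
      · refine s.2.2.2.trans ?_
        rw [Fin.range_cons, Set.insert_eq, AddSubgroup.closure_union,
          ← AddSubgroup.zmultiples_eq_closure, sup_assoc]
      · rintro ⟨⟨x, hx⟩, ⟨t, ht⟩⟩ ⟨⟨y, hy⟩, ⟨u, hu⟩⟩ h
        obtain ⟨rfl, rfl⟩ := Fin.cons_injective2 (α := fun _ => G) (congrArg Subtype.val h)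
        rfl
    have := Fintype.ofFinite W
    rw [Nat.card_sigma] at hinj
    have hsum : Nat.card W * Nat.card M ^ f ≤ 2 ^ f * Nat.card (genTuples V M (f + 1)) := by
      refine le_trans ?_ (Nat.mul_le_mul_left _ hinj)
      rw [Finset.mul_sum, Nat.card_eq_fintype_card, ← smul_eq_mul]
      exact Finset.card_nsmul_le_sum _ _ _ fun x _ => hstep x
    calc Nat.card M ^ (f + 1) = Nat.card M ^ f * Nat.card M := pow_succ _ _
      _ ≤ Nat.card M ^ f * (2 * Nat.card W) := Nat.mul_le_mul_left _ hW
      _ = 2 * (Nat.card W * Nat.card M ^ f) := by ring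
      _ ≤ 2 * (2 ^ f * Nat.card (genTuples V M (f + 1))) := Nat.mul_le_mul_left _ hsum
      _ = 2 ^ (f + 1) * Nat.card (genTuples V M (f + 1)) := by ring

/-- Double counting: disjoint large subsets of a finite set. -/
lemma card_mul_le_of_disjoint {ι Ω : Type*} [Finite Ω] (X : ι → Set Ω) (Y : Set Ω) (D E : ℕ)
    (hX : ∀ i, X i ⊆ Y) (hdisj : ∀ i j, ∀ x ∈ X i, x ∈ X j → i = j)
    (hE : ∀ i, E ≤ D * Nat.card (X i)) : Nat.card ι * E ≤ D * Nat.card Y := by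
  cases finite_or_infinite ι with
  | inr h => simp
  | inl h =>
    have := Fintype.ofFinite ι
    have h1 : Nat.card (Σ i, X i) ≤ Nat.card Y := by
      refine Nat.card_le_card_of_injective (fun s => ⟨s.2.1, hX _ s.2.2⟩) ?_
      rintro ⟨i, x, hx⟩ ⟨j, y, hy⟩ h
      simp only [Subtype.mk.injEq] at h
      subst h
      obtain rfl := hdisj i j x hx hy
      rfl
    rw [Nat.card_sigma] at h1
    refine le_trans ?_ (Nat.mul_le_mul_left D h1)
    rw [Finset.mul_sum, Nat.card_eq_fintype_card, ← smul_eq_mul]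
    exact Finset.card_nsmul_le_sum _ _ _ fun i _ => hE i

end Tuples

section Sampling

variable {A G : Type*} [AddCommGroup A] [AddCommGroup G]

lemma mem_genTuples_of_comp {π : A →+ G} {V M : AddSubgroup A} (hker : π.ker ≤ V)
    (hVM : V ≤ M) {f : ℕ} {x : Fin f → A}
    (hx : (fun i => π (x i)) ∈ genTuples (V.map π) (M.map π) f) : x ∈ genTuples V M f := by
  have hmem : ∀ {U : AddSubgroup A}, π.ker ≤ U → ∀ {a : A}, π a ∈ U.map π → a ∈ U := by
    rintro U hU a ⟨b, hb, hab⟩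
    have : a - b ∈ U := hU (by rw [AddMonoidHom.mem_ker, map_sub, hab, sub_self])
    simpa using U.add_mem this hb
  refine ⟨fun i => hmem (hker.trans hVM) (hx.1 i), fun m hm => ?_⟩
  refine hmem (hker.trans le_sup_left) ?_
  rw [AddSubgroup.map_sup, AddMonoidHom.map_closure, ← Set.range_comp]
  exact hx.2 (AddSubgroup.mem_map_of_mem π hm)

lemma card_pow_le_genTuples_map [Finite G] {p : ℕ} (hp : p.Prime) {π : A →+ G}
    (hπ : Function.Surjective π) {V M : AddSubgroup A} (hker : π.ker ≤ V) (hVM : V ≤ M)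
    (hpM : ∀ x ∈ M, p • x ∈ V) {f : ℕ} (hind : V.relIndex M = p ^ f) :
    Nat.card G ^ f ≤ 2 ^ f * M.index ^ f * Nat.card (genTuples (V.map π) (M.map π) f) := by
  have h := card_pow_le_genTuples hp f (V.map π) (M.map π) (AddSubgroup.map_mono hVM) ?_ ?_
  · rw [← AddSubgroup.card_mul_index (M.map π), AddSubgroup.index_map_eq M hπ (hker.trans hVM),
      mul_pow]
    calc Nat.card (M.map π) ^ f * M.index ^ f
        ≤ (2 ^ f * Nat.card (genTuples (V.map π) (M.map π) f)) * M.index ^ f :=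
          Nat.mul_le_mul_right _ h
      _ = _ := by ring
  · rintro _ ⟨x, hx, rfl⟩
    exact ⟨p • x, hpM x hx, map_nsmul π p x⟩
  · rw [AddSubgroup.relIndex_map_map, sup_eq_left.2 hker, sup_eq_left.2 (hker.trans hVM), hind]

end Sampling

section Determination

variable {A : Type*} [CommRing A] {p : ℕ} (hp : p.Prime) (hA : (multiples A p).index = p ^ 5)
include hp hA

lemma codim_four_eq_zero {O : Subring A}
    (hgen : Subring.closure (layer p O.toAddSubgroup 1 : Set A) = ⊤) :
    codim p O.toAddSubgroup 4 = 0 := by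
  have h0 := codim_zero_lt hp hA (by norm_num) O
  have h1 := codim_succ hp hA hgen 0 1 rfl
  have h2 := codim_succ hp hA hgen 1 2 rfl
  have h3 := codim_succ hp hA hgen 2 3 rfl
  have h4 := codim_succ hp hA hgen 3 4 rfl
  have h5 := codim_anti_right hp hA O.toAddSubgroup (show 0 ≤ 4 by norm_num)
  have h6 := codim_anti_right hp hA O.toAddSubgroup (show 1 ≤ 4 by norm_num)
  have h7 := codim_anti_right hp hA O.toAddSubgroup (show 2 ≤ 4 by norm_num)
  have h8 := codim_anti_right hp hA O.toAddSubgroup (show 3 ≤ 4 by norm_num)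
  omega

lemma index_level_of_generates {O : Subring A} {N : ℕ} (hN : ∀ x : A, (p : A) ^ N * x ∈ O)
    (hgen : Subring.closure (layer p O.toAddSubgroup 1 : Set A) = ⊤) {j k : ℕ} (hjk : j + k = 4) :
    (level p O.toAddSubgroup j).index =
      p ^ (∑ i ∈ Finset.range k, codim p O.toAddSubgroup (j + i)) := by
  rw [index_level_eq_pow hp hA _ j k, hjk, level_eq_top hp hA hN (codim_four_eq_zero hp hA hgen),
    AddSubgroup.index_top, mul_one]

/-- Two subrings sharing enough of their first layers agree. -/
lemma eq_of_layers_le {O O' : Subring A} {N : ℕ} (hN : ∀ x : A, (p : A) ^ N * x ∈ O)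
    (hN' : ∀ x : A, (p : A) ^ N * x ∈ O')
    (hgen : Subring.closure (layer p O.toAddSubgroup 1 : Set A) = ⊤)
    (hcod : ∀ j, codim p O.toAddSubgroup j = codim p O'.toAddSubgroup j)
    (h0 : layer p O.toAddSubgroup 0 ≤ layer p (O ⊓ O').toAddSubgroup 0)
    (h1 : layer p O.toAddSubgroup 1 ≤ layer p (O ⊓ O').toAddSubgroup 1)
    (h2 : codim p O.toAddSubgroup 2 = 0 ∨
      codim p O.toAddSubgroup 1 = codim p O.toAddSubgroup 2 + 1 ∨
      layer p O.toAddSubgroup 2 ≤ layer p (O ⊓ O').toAddSubgroup 2) : O ≤ O' := by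
  have hPO : (O ⊓ O').toAddSubgroup ≤ O.toAddSubgroup := fun x hx => hx.1
  have hle : ∀ j, codim p O.toAddSubgroup j ≤ codim p (O ⊓ O').toAddSubgroup j := fun j =>
    codim_le_of_layer_le hp hA (layer_mono hPO j)
  have hNP : ∀ x : A, (p : A) ^ N * x ∈ O ⊓ O' := fun x => ⟨hN x, hN' x⟩
  have hgenP : Subring.closure (layer p (O ⊓ O').toAddSubgroup 1 : Set A) = ⊤ := by
    rw [eq_top_iff, ← hgen]
    exact Subring.closure_mono h1
  have hzero : ∀ j, codim p O.toAddSubgroup j = 0 → codim p (O ⊓ O').toAddSubgroup j = 0 := by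
    intro j hj
    have ht := level_eq_top hp hA hN hj
    have ht' := level_eq_top hp hA hN' ((hcod j).symm.trans hj)
    refine codim_eq_zero (eq_top_iff.2 (le_trans ?_ (level_le_layer _ j)))
    intro x _
    have hx : x ∈ level p O.toAddSubgroup j := by rw [ht]; trivial
    have hx' : x ∈ level p O'.toAddSubgroup j := by rw [ht']; trivial
    exact ⟨hx, hx'⟩
  have e0 := codim_le_of_layer_le hp hA h0
  have e1 := codim_le_of_layer_le hp hA h1
  have e2 : codim p O.toAddSubgroup 2 = 0 ∨
      codim p O.toAddSubgroup 1 = codim p O.toAddSubgroup 2 + 1 ∨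
      codim p (O ⊓ O').toAddSubgroup 2 ≤ codim p O.toAddSubgroup 2 :=
    h2.imp_right (Or.imp_right fun h => codim_le_of_layer_le hp hA h)
  have c0 := codim_zero_lt hp hA (by norm_num) O
  have c1 := codim_succ hp hA hgen 0 1 rfl
  have c2 := codim_succ hp hA hgen 1 2 rfl
  have c3 := codim_succ hp hA hgen 2 3 rfl
  have d1 := codim_succ hp hA hgenP 0 1 rfl
  have d2 := codim_succ hp hA hgenP 1 2 rfl
  have d3 := codim_succ hp hA hgenP 2 3 rfl
  have z1 := hzero 1
  have z2 := hzero 2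
  have z3 := hzero 3
  have l0 := hle 0
  have l1 := hle 1
  have l2 := hle 2
  have l3 := hle 3
  have hindex : (O ⊓ O').toAddSubgroup.index = O.toAddSubgroup.index := by
    rw [← level_zero (p := p) (O ⊓ O').toAddSubgroup, ← level_zero (p := p) O.toAddSubgroup,
      index_level_of_generates hp hA hNP hgenP (k := 4) rfl,
      index_level_of_generates hp hA hN hgen (k := 4) rfl]
    congr 1
    simp only [Finset.sum_range_succ, Finset.sum_range_zero, zero_add]
    omega
  have hne : O.toAddSubgroup.index ≠ 0 := by
    rw [← level_zero (p := p) O.toAddSubgroup,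
      index_level_of_generates hp hA hN hgen (k := 4) rfl]
    exact pow_ne_zero _ hp.ne_zero
  intro x hx
  have : x ∈ (O ⊓ O').toAddSubgroup := by
    rw [eq_of_le_of_index_eq hPO hindex hne]
    exact hx
  exact this.2

lemma relIndex_inf_layer (H : AddSubgroup A) (j : ℕ) :
    (level p H (j + 1) ⊓ layer p H j).relIndex (level p H (j + 1)) =
      p ^ (codim p H j - codim p H (j + 1)) := by
  rw [AddSubgroup.inf_relIndex_left, ← AddSubgroup.relIndex_sup_left]
  have h : layer p H j ⊔ level p H (j + 1) = layer p H (j + 1) := by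
    refine le_antisymm (sup_le (layer_le_layer H (Nat.le_succ j)) (level_le_layer _ _)) ?_
    exact sup_le le_sup_right ((multiples_le_layer H j).trans le_sup_left)
  rw [h]
  have hm := AddSubgroup.relIndex_mul_index (layer_le_layer (p := p) H (Nat.le_succ j))
  rw [index_layer hp hA, index_layer hp hA] at hm
  have hle := codim_anti_right hp hA H (Nat.le_succ j)
  rw [← Nat.sub_add_cancel hle, pow_add] at hm
  exact Nat.eq_of_mul_eq_mul_right (pow_pos hp.pos _) hm

end Determination

section Family

variable {A : Type*} [CommRing A] {p : ℕ}

/-- Subrings generating `A` through their first layer, with prescribed codimensions of all layers,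
and with the same zeroth layer as their pairwise intersections. -/
structure IsFamily (p N : ℕ) (a : ℕ → ℕ) (F : Set (Subring A)) : Prop where
  pow_mem : ∀ O ∈ F, ∀ x : A, (p : A) ^ N * x ∈ O
  generates : ∀ O ∈ F, Subring.closure (layer p O.toAddSubgroup 1 : Set A) = ⊤
  codim_eq : ∀ O ∈ F, ∀ j, codim p O.toAddSubgroup j = a j
  layer_zero_le : ∀ O ∈ F, ∀ O' ∈ F,
    layer p O.toAddSubgroup 0 ≤ layer p (O ⊓ O').toAddSubgroup 0

/-- The subgroup `p ^ N A`. -/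
def powMultiples (A : Type*) [CommRing A] (p N : ℕ) : AddSubgroup A :=
  (AddMonoidHom.mulLeft ((p : A) ^ N)).range

lemma powMultiples_le_of_pow_mem {N : ℕ} {O : Subring A} (h : ∀ x : A, (p : A) ^ N * x ∈ O) :
    powMultiples A p N ≤ O.toAddSubgroup := by
  rintro _ ⟨x, rfl⟩
  exact h x

lemma le_level (H : AddSubgroup A) (j : ℕ) : H ≤ level p H j := by
  have h := level_le_level (p := p) H (Nat.zero_le j)
  rwa [level_zero] at h

lemma layer_succ_le_of_mem_genTuples {O O' : Subring A} {j f : ℕ} {x : Fin f → A}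
    (hx : x ∈ genTuples (level p O.toAddSubgroup (j + 1) ⊓ layer p O.toAddSubgroup j)
      (level p O.toAddSubgroup (j + 1)) f)
    (hx' : x ∈ genTuples (level p O'.toAddSubgroup (j + 1) ⊓ layer p O'.toAddSubgroup j)
      (level p O'.toAddSubgroup (j + 1)) f)
    (hj : layer p O.toAddSubgroup j ≤ layer p (O ⊓ O').toAddSubgroup j) :
    layer p O.toAddSubgroup (j + 1) ≤ layer p (O ⊓ O').toAddSubgroup (j + 1) := by
  refine sup_le (hx.2.trans (sup_le ?_ ?_)) (multiples_le_layer _ _)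
  · exact inf_le_right.trans (hj.trans (layer_le_layer _ (Nat.le_succ j)))
  · rw [AddSubgroup.closure_le]
    rintro _ ⟨i, rfl⟩
    exact level_le_layer _ _ ⟨hx.1 i, hx'.1 i⟩

/-- The reductions modulo `p ^ N` of the tuples generating the `j + 1`-st layer modulo the
`j`-th one. -/
def sample (p N : ℕ) (O : Subring A) (j f : ℕ) : Set (Fin f → A ⧸ powMultiples A p N) :=
  genTuples
    ((level p O.toAddSubgroup (j + 1) ⊓ layer p O.toAddSubgroup j).map
      (QuotientAddGroup.mk' (powMultiples A p N)))
    ((level p O.toAddSubgroup (j + 1)).map (QuotientAddGroup.mk' (powMultiples A p N))) f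

lemma powMultiples_le_inf {N : ℕ} {O : Subring A} (h : ∀ x : A, (p : A) ^ N * x ∈ O) (j : ℕ) :
    (QuotientAddGroup.mk' (powMultiples A p N)).ker ≤
      level p O.toAddSubgroup (j + 1) ⊓ layer p O.toAddSubgroup j := by
  rw [QuotientAddGroup.ker_mk']
  have hle := powMultiples_le_of_pow_mem h
  exact le_inf (hle.trans (le_level _ _)) (hle.trans ((le_level _ _).trans (level_le_layer _ _)))

lemma layer_succ_le_of_mem_sample {N : ℕ} {O O' : Subring A}
    (h : ∀ x : A, (p : A) ^ N * x ∈ O) (h' : ∀ x : A, (p : A) ^ N * x ∈ O') {j f : ℕ}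
    {x : Fin f → A ⧸ powMultiples A p N} (hx : x ∈ sample p N O j f) (hx' : x ∈ sample p N O' j f)
    (hj : layer p O.toAddSubgroup j ≤ layer p (O ⊓ O').toAddSubgroup j) :
    layer p O.toAddSubgroup (j + 1) ≤ layer p (O ⊓ O').toAddSubgroup (j + 1) := by
  choose y hy using fun i => QuotientAddGroup.mk'_surjective (powMultiples A p N) (x i)
  obtain rfl : (fun i => QuotientAddGroup.mk' (powMultiples A p N) (y i)) = x := funext hy
  exact layer_succ_le_of_mem_genTuples
    (mem_genTuples_of_comp (powMultiples_le_inf h j) inf_le_left hx)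
    (mem_genTuples_of_comp (powMultiples_le_inf h' j) inf_le_left hx') hj

variable (hp : p.Prime) (hA : (multiples A p).index = p ^ 5)
include hp hA

lemma finite_quotient_powMultiples (N : ℕ) : Finite (A ⧸ powMultiples A p N) := by
  have : (powMultiples A p N).index ≠ 0 := by
    have htop : level p (powMultiples A p N) (0 + N) = ⊤ := by
      rw [eq_top_iff, zero_add]
      exact fun x _ => ⟨x, rfl⟩
    rw [← level_zero (p := p) (powMultiples A p N), index_level_eq_pow hp hA _ 0 N, htop,
      AddSubgroup.index_top, mul_one]
    exact pow_ne_zero _ hp.ne_zero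
  have : (powMultiples A p N).FiniteIndex := ⟨this⟩
  exact AddSubgroup.finite_quotient_of_finiteIndex

lemma card_pow_le_sample {N : ℕ} {O : Subring A} (h : ∀ x : A, (p : A) ^ N * x ∈ O) {j f : ℕ}
    (hf : codim p O.toAddSubgroup j - codim p O.toAddSubgroup (j + 1) = f) :
    Nat.card (A ⧸ powMultiples A p N) ^ f ≤
      2 ^ f * (level p O.toAddSubgroup (j + 1)).index ^ f * Nat.card (sample p N O j f) := by
  have := finite_quotient_powMultiples hp hA N
  refine card_pow_le_genTuples_map hp (QuotientAddGroup.mk'_surjective _)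
    (powMultiples_le_inf h j) inf_le_left ?_ ?_
  · intro x hx
    refine ⟨AddSubgroup.nsmul_mem _ hx p, multiples_le_layer _ _ ?_⟩
    rw [nsmul_eq_mul]
    exact mul_mem_multiples x
  · rw [relIndex_inf_layer hp hA, hf]

variable {N : ℕ} {a : ℕ → ℕ} {F : Set (Subring A)} (hF : IsFamily p N a F)
include hF

lemma IsFamily.card_mul_le (hcase : a 2 = 0 ∨ a 1 = a 2 + 1)
    {f : ℕ} (hf : a 0 - a 1 = f) (Y : Set (Fin f → A ⧸ powMultiples A p N))
    (hY : ∀ O ∈ F, sample p N O 0 f ⊆ Y) :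
    Nat.card F * Nat.card (A ⧸ powMultiples A p N) ^ f ≤
      2 ^ f * p ^ (f * (a 1 + a 2 + a 3)) * Nat.card Y := by
  have := finite_quotient_powMultiples hp hA N
  refine card_mul_le_of_disjoint (fun O : F => sample p N O.1 0 f) Y _ _
    (fun O => hY _ O.2) ?_ ?_
  · rintro ⟨O, hO⟩ ⟨O', hO'⟩ x hx hx'
    have key : ∀ O ∈ F, ∀ O' ∈ F, x ∈ sample p N O 0 f → x ∈ sample p N O' 0 f → O ≤ O' := by
      intro O hO O' hO' hx hx'
      refine eq_of_layers_le hp hA (hF.pow_mem O hO) (hF.pow_mem O' hO') (hF.generates O hO)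
        (fun j => by rw [hF.codim_eq O hO, hF.codim_eq O' hO']) (hF.layer_zero_le O hO O' hO')
        (layer_succ_le_of_mem_sample (hF.pow_mem O hO) (hF.pow_mem O' hO') hx hx'
          (hF.layer_zero_le O hO O' hO')) ?_
      rw [hF.codim_eq O hO, hF.codim_eq O hO, ← or_assoc]
      exact Or.inl hcase
    exact Subtype.ext (le_antisymm (key O hO O' hO' hx hx') (key O' hO' O hO hx' hx))
  · rintro ⟨O, hO⟩
    have h := card_pow_le_sample hp hA (hF.pow_mem O hO) (j := 0) (f := f)
      (by rw [hF.codim_eq O hO, hF.codim_eq O hO]; exact hf)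
    rw [index_level_of_generates hp hA (hF.pow_mem O hO) (hF.generates O hO)
      (j := 0 + 1) (k := 3) rfl] at h
    simp only [Finset.sum_range_succ, Finset.sum_range_zero, zero_add, hF.codim_eq O hO] at h
    rwa [← pow_mul, mul_comm (_ + _) f] at h

lemma IsFamily.card_le (hcase : a 2 = 0 ∨ a 1 = a 2 + 1) :
    Nat.card F ≤ 2 ^ (a 0 - a 1) * p ^ ((a 0 - a 1) * (a 1 + a 2 + a 3)) := by
  have := finite_quotient_powMultiples hp hA N
  have h := hF.card_mul_le hp hA hcase rfl Set.univ (fun _ _ => Set.subset_univ _)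
  rw [Nat.card_coe_set_eq Set.univ, Set.ncard_univ, Nat.card_fun, Nat.card_fin] at h
  exact Nat.le_of_mul_le_mul_right h (pow_pos Nat.card_pos _)

lemma IsFamily.card_le' :
    Nat.card F ≤ 2 ^ (a 0 - a 1) * 2 ^ (a 1 - a 2) *
      p ^ ((a 0 - a 1) * (a 1 + a 2 + a 3) + (a 1 - a 2) * (a 2 + a 3)) := by
  have := finite_quotient_powMultiples hp hA N
  have h := card_mul_le_of_disjoint
    (fun O : F => sample p N O.1 0 (a 0 - a 1) ×ˢ sample p N O.1 1 (a 1 - a 2)) Set.univ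
    (2 ^ (a 0 - a 1) * 2 ^ (a 1 - a 2) *
      p ^ ((a 0 - a 1) * (a 1 + a 2 + a 3) + (a 1 - a 2) * (a 2 + a 3)))
    (Nat.card (A ⧸ powMultiples A p N) ^ (a 0 - a 1) *
      Nat.card (A ⧸ powMultiples A p N) ^ (a 1 - a 2)) (fun _ => Set.subset_univ _) ?_ ?_
  · rw [Nat.card_coe_set_eq Set.univ, Set.ncard_univ, Nat.card_prod, Nat.card_fun, Nat.card_fun,
      Nat.card_fin, Nat.card_fin] at h
    exact Nat.le_of_mul_le_mul_right h (Nat.mul_pos (pow_pos Nat.card_pos _)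
      (pow_pos Nat.card_pos _))
  · rintro ⟨O, hO⟩ ⟨O', hO'⟩ ⟨x, y⟩ ⟨hx, hy⟩ ⟨hx', hy'⟩
    have key : ∀ O ∈ F, ∀ O' ∈ F, x ∈ sample p N O 0 _ → x ∈ sample p N O' 0 _ →
        y ∈ sample p N O 1 _ → y ∈ sample p N O' 1 _ → O ≤ O' := by
      intro O hO O' hO' hx hx' hy hy'
      have h1 := layer_succ_le_of_mem_sample (hF.pow_mem O hO) (hF.pow_mem O' hO') hx hx'
          (hF.layer_zero_le O hO O' hO')
      have h2 := layer_succ_le_of_mem_sample (hF.pow_mem O hO) (hF.pow_mem O' hO') hy hy' h1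
      exact eq_of_layers_le hp hA (hF.pow_mem O hO) (hF.pow_mem O' hO') (hF.generates O hO)
        (fun j => by rw [hF.codim_eq O hO, hF.codim_eq O' hO']) (hF.layer_zero_le O hO O' hO')
        h1 (Or.inr (Or.inr h2))
    exact Subtype.ext (le_antisymm (key O hO O' hO' hx hx' hy hy')
      (key O' hO' O hO hx' hx hy' hy))
  · rintro ⟨O, hO⟩
    have h1 := card_pow_le_sample hp hA (hF.pow_mem O hO) (j := 0) (f := a 0 - a 1)
      (by rw [hF.codim_eq O hO, hF.codim_eq O hO])
    have h2 := card_pow_le_sample hp hA (hF.pow_mem O hO) (j := 1) (f := a 1 - a 2)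
      (by rw [hF.codim_eq O hO, hF.codim_eq O hO])
    rw [index_level_of_generates hp hA (hF.pow_mem O hO) (hF.generates O hO)
      (j := 0 + 1) (k := 3) rfl] at h1
    rw [index_level_of_generates hp hA (hF.pow_mem O hO) (hF.generates O hO)
      (j := 1 + 1) (k := 2) rfl] at h2
    simp only [Finset.sum_range_succ, Finset.sum_range_zero, zero_add, hF.codim_eq O hO] at h1 h2
    rw [← pow_mul, mul_comm (_ + _) (_ - _)] at h1 h2
    have h3 : Nat.card ↑(sample p N O 0 (a 0 - a 1) ×ˢ sample p N O 1 (a 1 - a 2)) =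
        Nat.card (sample p N O 0 (a 0 - a 1)) * Nat.card (sample p N O 1 (a 1 - a 2)) := by
      rw [Nat.card_coe_set_eq, Set.ncard_prod, Nat.card_coe_set_eq, Nat.card_coe_set_eq]
    rw [h3, pow_add]
    refine (Nat.mul_le_mul h1 h2).trans (le_of_eq ?_)
    norm_num
    ring

end Family

section ReducedAlgebra

open Polynomial

variable {p : ℕ} [Fact p.Prime] {B : Type*} [CommRing B] [IsReduced B]

lemma card_maximalSpectrum_le [Finite B] (hB : Nat.card B = p ^ 5) :
    Finite (MaximalSpectrum B) ∧ Nat.card (MaximalSpectrum B) ≤ 5 := by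
  have hp : p.Prime := Fact.out
  have hfin : Finite (MaximalSpectrum B) := inferInstance
  refine ⟨hfin, ?_⟩
  have := Fintype.ofFinite (MaximalSpectrum B)
  have e := Nat.card_congr (IsArtinianRing.equivPi B).toEquiv
  rw [hB, Nat.card_pi] at e
  have hk : ∀ I : MaximalSpectrum B, p ≤ Nat.card (B ⧸ I.asIdeal) := by
    intro I
    have hd : Nat.card (B ⧸ I.asIdeal) ∣ p ^ 5 := by
      rw [← hB]
      exact AddSubgroup.card_quotient_dvd_card I.asIdeal.toAddSubgroup
    obtain ⟨k, -, hk⟩ := (Nat.dvd_prime_pow hp).1 hd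
    have : Nontrivial (B ⧸ I.asIdeal) := Ideal.Quotient.nontrivial_iff.2 I.isMaximal.ne_top
    have : Finite (B ⧸ I.asIdeal) := Finite.of_surjective _ Ideal.Quotient.mk_surjective
    have h1 : 1 < Nat.card (B ⧸ I.asIdeal) := Finite.one_lt_card
    rw [hk] at h1 ⊢
    refine Nat.le_self_pow ?_ p
    rintro rfl
    simp at h1
  have h2 : p ^ Nat.card (MaximalSpectrum B) ≤ p ^ 5 := by
    rw [e, Nat.card_eq_fintype_card, ← Finset.card_univ]
    exact Finset.pow_card_le_prod _ _ _ fun I _ => hk I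
  exact (Nat.pow_le_pow_iff_right hp.one_lt).1 h2

variable [Algebra (ZMod p) B] [Finite B] (hB : Nat.card B = p ^ 5)
include hB

lemma card_roots_le {e : ℕ} (he : e ≤ 5) {q : (ZMod p)[X]} (hq : q.Monic) (hqe : q.natDegree = e) :
    Nat.card {x : B // aeval x q = 0} ≤ 5 ^ 5 := by
  classical
  obtain ⟨hfin, hcard⟩ := card_maximalSpectrum_le hB
  have := Fintype.ofFinite (MaximalSpectrum B)
  have hfield (I : MaximalSpectrum B) : IsDomain (B ⧸ I.asIdeal) := inferInstance
  let Q (I : MaximalSpectrum B) : (B ⧸ I.asIdeal)[X] :=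
    q.map ((Ideal.Quotient.mk I.asIdeal).comp (algebraMap (ZMod p) B))
  have hQ (I) : (Q I).Monic := hq.map _
  have hroot (x : B) (hx : aeval x q = 0) (I) :
      Ideal.Quotient.mk I.asIdeal x ∈ (Q I).roots.toFinset := by
    rw [Multiset.mem_toFinset, mem_roots (hQ I).ne_zero, IsRoot.def, eval_map,
      ← hom_eval₂, ← aeval_def, hx, map_zero]
  have h1 : Nat.card {x : B // aeval x q = 0} ≤
      Nat.card (∀ I : MaximalSpectrum B, (Q I).roots.toFinset) := by
    refine Nat.card_le_card_of_injective (fun x I => ⟨_, hroot x.1 x.2 I⟩) ?_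
    intro x y hxy
    apply Subtype.ext
    apply (IsArtinianRing.equivPi B).injective
    funext I
    exact congrArg Subtype.val (congrFun hxy I)
  refine h1.trans ?_
  rw [Nat.card_pi]
  calc ∏ I : MaximalSpectrum B, Nat.card (Q I).roots.toFinset
      ≤ ∏ _I : MaximalSpectrum B, 5 := by
        refine Finset.prod_le_prod' fun I _ => ?_
        rw [Nat.card_eq_fintype_card, Fintype.card_coe]
        refine (Multiset.toFinset_card_le _).trans ((card_roots' _).trans ?_)
        exact natDegree_map_le.trans (hqe.le.trans he)
    _ ≤ 5 ^ 5 := by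
        rw [Finset.prod_const, Finset.card_univ, ← Nat.card_eq_fintype_card]
        exact Nat.pow_le_pow_right (by norm_num) hcard

lemma card_natDegree_minpoly_le {e : ℕ} (he : e ≤ 5) :
    Nat.card {x : B // (minpoly (ZMod p) x).natDegree ≤ e} ≤ 5 ^ 5 * p ^ e := by
  have hp : p.Prime := Fact.out
  let P (c : degreeLT (ZMod p) e) : (ZMod p)[X] := X ^ e + (c : (ZMod p)[X])
  have hP (c : degreeLT (ZMod p) e) : (P c).Monic ∧ (P c).natDegree = e := by
    have hc := mem_degreeLT.1 c.2
    have hm : (P c).Monic := monic_X_pow_add hc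
    refine ⟨hm, natDegree_eq_of_degree_eq_some ?_⟩
    rw [degree_add_eq_left_of_degree_lt (by rwa [degree_X_pow]), degree_X_pow]
  have hex (x : {x : B // (minpoly (ZMod p) x).natDegree ≤ e}) :
      ∃ c : degreeLT (ZMod p) e, aeval x.1 (P c) = 0 := by
    obtain ⟨x, hx⟩ := x
    have hx_int : IsIntegral (ZMod p) x := Algebra.IsIntegral.isIntegral x
    set q : (ZMod p)[X] := minpoly (ZMod p) x * X ^ (e - (minpoly (ZMod p) x).natDegree) with hq
    have hqm : q.Monic := (minpoly.monic hx_int).mul (monic_X_pow _)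
    have hqd : q.natDegree = e := by
      rw [hq, (minpoly.monic hx_int).natDegree_mul (monic_X_pow _), natDegree_X_pow]
      omega
    refine ⟨⟨q - X ^ e, mem_degreeLT.2 ?_⟩, ?_⟩
    · have hdeg : q.degree = (e : WithBot ℕ) := by
        rw [degree_eq_natDegree hqm.ne_zero, hqd]
      refine (degree_sub_lt_left ?_ hqm.ne_zero ?_).trans_eq hdeg
      · rw [hdeg, degree_X_pow]
      · rw [hqm.leadingCoeff, (monic_X_pow e).leadingCoeff]
    · simp only [P, add_sub_cancel]
      rw [hq, map_mul, minpoly.aeval, zero_mul]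
  choose c hc using hex
  have : Finite (degreeLT (ZMod p) e) := Finite.of_equiv _ (degreeLTEquiv (ZMod p) e).symm.toEquiv
  have := Fintype.ofFinite (degreeLT (ZMod p) e)
  have h1 : Nat.card {x : B // (minpoly (ZMod p) x).natDegree ≤ e} ≤
      Nat.card (Σ c : degreeLT (ZMod p) e, {x : B // aeval x (P c) = 0}) := by
    refine Nat.card_le_card_of_injective (fun x => ⟨c x, ⟨x.1, hc x⟩⟩) ?_
    intro x y hxy
    exact Subtype.ext (congrArg (fun s => (s.2 : B)) hxy)
  refine h1.trans ?_
  rw [Nat.card_sigma]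
  refine (Finset.sum_le_card_nsmul _ _ (5 ^ 5) fun c _ =>
    card_roots_le hB he (hP c).1 (hP c).2).trans_eq ?_
  rw [Finset.card_univ, ← Nat.card_eq_fintype_card, Nat.card_congr (degreeLTEquiv (ZMod p) e).toEquiv,
    Nat.card_fun, Nat.card_fin, Nat.card_zmod, smul_eq_mul, mul_comm]

end ReducedAlgebra

section SubringCount

open Polynomial

variable {p : ℕ} [Fact p.Prime] {B : Type*} [CommRing B] [Algebra (ZMod p) B] [Finite B]

lemma span_pow_of_mem_subring {S : Subring B} {d : ℕ} (hS : Nat.card S = p ^ d) {x : B}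
    (hx : x ∈ S) : (minpoly (ZMod p) x).natDegree ≤ d ∧
      ((minpoly (ZMod p) x).natDegree = d →
        Submodule.span (ZMod p)
          (Set.range fun i : Fin (minpoly (ZMod p) x).natDegree => x ^ (i : ℕ)) =
        AddSubgroup.toZModSubmodule p S.toAddSubgroup) := by
  have hp : p.Prime := Fact.out
  set V := AddSubgroup.toZModSubmodule p S.toAddSubgroup with hV
  have hmem : ∀ y, y ∈ V ↔ y ∈ S := fun y => Iff.rfl
  have hfr : Module.finrank (ZMod p) V = d := by
    have h := Module.natCard_eq_pow_finrank (K := ZMod p) (V := V)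
    rw [Nat.card_zmod] at h
    have h' : Nat.card V = p ^ d := hS
    exact Nat.pow_right_injective hp.two_le (h.symm.trans h')
  have hli := linearIndependent_pow (K := ZMod p) x
  have hle : Submodule.span (ZMod p)
      (Set.range fun i : Fin (minpoly (ZMod p) x).natDegree => x ^ (i : ℕ)) ≤ V := by
    rw [Submodule.span_le]
    rintro _ ⟨i, rfl⟩
    exact (hmem _).2 (S.pow_mem hx _)
  have hfs := finrank_span_eq_card hli
  rw [Fintype.card_fin] at hfs
  refine ⟨?_, fun h => Submodule.eq_of_le_of_finrank_eq hle (by rw [hfs, h, hfr])⟩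
  rw [← hfs, ← hfr]
  exact Submodule.finrank_mono hle

variable [IsReduced B] (hB : Nat.card B = p ^ 5) (hp5 : 2 * 5 ^ 5 ≤ p)
include hB hp5

lemma card_subring_of_card_le {d : ℕ} (hd : d ≤ 5) :
    Nat.card {S : Subring B // Nat.card S = p ^ d} ≤ 2 * 5 ^ 5 := by
  have hp : p.Prime := Fact.out
  have : Nontrivial B := by
    rw [← Finite.one_lt_card_iff_nontrivial, hB]
    exact Nat.one_lt_pow (by norm_num) hp.one_lt
  rcases d with _ | d
  · have : IsEmpty {S : Subring B // Nat.card S = p ^ 0} := by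
      refine ⟨fun ⟨S, hS⟩ => ?_⟩
      have h := (Finite.one_lt_card : 1 < Nat.card S)
      rw [hS] at h
      simp at h
    rw [Nat.card_of_isEmpty]
    exact Nat.zero_le _
  have h := card_mul_le_of_disjoint
    (fun S : {S : Subring B // Nat.card S = p ^ (d + 1)} =>
      {x : B | x ∈ S.1 ∧ (minpoly (ZMod p) x).natDegree = d + 1})
    {x : B | (minpoly (ZMod p) x).natDegree ≤ d + 1} 2 (p ^ (d + 1))
    (fun S x hx => hx.2.le) ?_ ?_
  · have h1 := card_natDegree_minpoly_le hB hd
    have h2 : Nat.card {S : Subring B // Nat.card S = p ^ (d + 1)} * p ^ (d + 1) ≤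
        2 * 5 ^ 5 * p ^ (d + 1) := by
      refine h.trans ?_
      rw [mul_assoc]
      exact Nat.mul_le_mul_left 2 h1
    exact Nat.le_of_mul_le_mul_right h2 (pow_pos hp.pos _)
  · rintro ⟨S, hS⟩ ⟨S', hS'⟩ x ⟨hx, hxd⟩ ⟨hx', -⟩
    have e := ((span_pow_of_mem_subring hS hx).2 hxd).symm.trans
      ((span_pow_of_mem_subring hS' hx').2 hxd)
    refine Subtype.ext (Subring.ext fun y => ?_)
    exact SetLike.ext_iff.1 e y
  · rintro ⟨S, hS⟩
    have h1 : (S : Set B) ⊆ {x : B | x ∈ S ∧ (minpoly (ZMod p) x).natDegree = d + 1} ∪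
        {x : B | (minpoly (ZMod p) x).natDegree ≤ d} := by
      intro x hx
      have := (span_pow_of_mem_subring hS hx).1
      rcases this.eq_or_lt with h | h
      · exact Or.inl ⟨hx, h⟩
      · exact Or.inr (Nat.lt_succ_iff.1 h)
    have h2 := (Set.ncard_le_ncard h1 (Set.toFinite _)).trans (Set.ncard_union_le _ _)
    have h3 : Set.ncard {x : B | (minpoly (ZMod p) x).natDegree ≤ d} ≤ 5 ^ 5 * p ^ d :=
      card_natDegree_minpoly_le hB (by omega)
    have h4 : Set.ncard (S : Set B) = p ^ (d + 1) := hS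
    have h5 : 2 * 5 ^ 5 * p ^ d ≤ p ^ (d + 1) := by
      rw [pow_succ' p]
      exact Nat.mul_le_mul_right _ hp5
    rw [h4] at h2
    change _ ≤ 2 * Set.ncard {x : B | x ∈ S ∧ (minpoly (ZMod p) x).natDegree = d + 1}
    omega

lemma card_subring_le : Nat.card (Subring B) ≤ 12 * 5 ^ 5 := by
  have hp : p.Prime := Fact.out
  have hfin : Finite (Subring B) := Finite.of_injective _ (SetLike.coe_injective (A := Subring B))
  have hex (S : Subring B) : ∃ d : Fin 6, Nat.card S = p ^ (d : ℕ) := by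
    have hd : Nat.card S ∣ p ^ 5 := by
      rw [← hB]
      exact AddSubgroup.card_addSubgroup_dvd_card S.toAddSubgroup
    obtain ⟨k, hk, hk'⟩ := (Nat.dvd_prime_pow hp).1 hd
    exact ⟨⟨k, by omega⟩, hk'⟩
  choose d hd using hex
  have h1 : Nat.card (Subring B) ≤
      Nat.card (Σ d : Fin 6, {S : Subring B // Nat.card S = p ^ (d : ℕ)}) := by
    refine Nat.card_le_card_of_injective (fun S => ⟨d S, ⟨S, hd S⟩⟩) ?_
    intro S S' h
    exact congrArg (fun s => (s.2 : Subring B)) h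
  refine h1.trans ?_
  rw [Nat.card_sigma]
  refine (Finset.sum_le_card_nsmul _ _ (2 * 5 ^ 5) fun d _ =>
    card_subring_of_card_le hB hp5 (by omega)).trans_eq ?_
  simp

end SubringCount

section DegeneratePairs

open Polynomial

variable {p : ℕ} [Fact p.Prime] {B : Type*} [CommRing B] [Finite B]

lemma card_mul_eq_zero_le [IsReduced B] (hB : Nat.card B = p ^ 5) :
    Nat.card {w : B × B // w.1 * w.2 = 0} ≤ 2 ^ 5 * p ^ 5 := by
  classical
  obtain ⟨hfin, hcard⟩ := card_maximalSpectrum_le hB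
  have h1 : Nat.card {w : B × B // w.1 * w.2 = 0} ≤
      Nat.card ((MaximalSpectrum B → Bool) × B) := by
    refine Nat.card_le_card_of_injective
      (fun w => (fun I => decide (w.1.1 ∈ I.asIdeal), w.1.1 + w.1.2)) ?_
    rintro ⟨⟨x, z⟩, h⟩ ⟨⟨x', z'⟩, h'⟩ hw
    obtain ⟨hw1, hw2⟩ := Prod.mk.inj hw
    simp only at h h' hw1 hw2
    have hx : x = x' := by
      apply (IsArtinianRing.equivPi B).injective
      funext I
      have hI := congrFun hw1 I
      rw [decide_eq_decide] at hI
      change Ideal.Quotient.mk I.asIdeal x = Ideal.Quotient.mk I.asIdeal x'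
      rw [Ideal.Quotient.eq]
      by_cases hxI : x ∈ I.asIdeal
      · exact I.asIdeal.sub_mem hxI (hI.1 hxI)
      · have hz : z ∈ I.asIdeal :=
          (I.isMaximal.isPrime.mem_or_mem (h ▸ I.asIdeal.zero_mem)).resolve_left hxI
        have hz' : z' ∈ I.asIdeal :=
          (I.isMaximal.isPrime.mem_or_mem (h' ▸ I.asIdeal.zero_mem)).resolve_left
            fun hx' => hxI (hI.2 hx')
        rw [show x - x' = z' - z by linear_combination hw2]
        exact I.asIdeal.sub_mem hz' hz
    subst hx
    rw [add_right_inj] at hw2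
    subst hw2
    rfl
  refine h1.trans ?_
  rw [Nat.card_prod, Nat.card_fun, hB, Nat.card_eq_fintype_card, Fintype.card_bool]
  exact Nat.mul_le_mul_right _ (Nat.pow_le_pow_right (by norm_num) hcard)

variable [Algebra (ZMod p) B]

lemma exists_relation_of_mem_proper (hB : Nat.card B = p ^ 5) {V : Submodule (ZMod p) B}
    (hV : V ≠ ⊤) {x y : B} (h1 : 1 ∈ V) (hx : x ∈ V) (hxx : x ^ 2 ∈ V) (hy : y ∈ V)
    (hxy : x * y ∈ V) :
    (minpoly (ZMod p) x).natDegree ≤ 2 ∨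
      ∃ c : Fin 3 → ZMod p, y = c 0 • 1 + c 1 • x + c 2 • x ^ 2 ∨
        ∃ t : ZMod p, (x - t • 1) * y = c 0 • 1 + c 1 • x + c 2 • x ^ 2 := by
  have hp : p.Prime := Fact.out
  have hfr : Module.finrank (ZMod p) B = 5 := by
    have h := Module.natCard_eq_pow_finrank (K := ZMod p) (V := B)
    rw [Nat.card_zmod, hB] at h
    exact Nat.pow_right_injective hp.two_le h.symm
  have hnot : ¬ LinearIndependent (ZMod p) ![1, x, x ^ 2, y, x * y] := by
    intro hli
    apply hV
    have hs := finrank_span_eq_card hli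
    rw [Fintype.card_fin] at hs
    rw [eq_top_iff, ← Submodule.eq_top_of_finrank_eq (hs.trans hfr.symm), Submodule.span_le]
    rintro _ ⟨i, rfl⟩
    fin_cases i <;> assumption
  obtain ⟨g, hg, i, hi⟩ := Fintype.not_linearIndependent_iff.1 hnot
  simp only [Fin.sum_univ_five, Matrix.cons_val] at hg
  by_cases h4 : g 4 = 0
  · by_cases h3 : g 3 = 0
    · left
      have hne : C (g 2) * X ^ 2 + C (g 1) * X + C (g 0) ≠ 0 := by
        intro h0
        have e0 := congrArg (fun q => coeff q 0) h0
        have e1 := congrArg (fun q => coeff q 1) h0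
        have e2 := congrArg (fun q => coeff q 2) h0
        simp [coeff_X, coeff_C] at e0 e1 e2
        apply hi
        fin_cases i <;> assumption
      refine (natDegree_le_natDegree (minpoly.degree_le_of_ne_zero (ZMod p) x hne ?_)).trans
        natDegree_quadratic_le
      rw [h3, h4, zero_smul, zero_smul, add_zero, add_zero] at hg
      rw [← hg]
      simp only [map_add, map_mul, aeval_C, aeval_X, map_pow, Algebra.smul_def]
      ring
    · right
      refine ⟨fun i => -(g 3)⁻¹ * g (Fin.castLE (by norm_num) i), Or.inl ?_⟩
      rw [h4, zero_smul, add_zero] at hg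
      have : y = (g 3)⁻¹ • (g 3 • y) := by rw [smul_smul, inv_mul_cancel₀ h3, one_smul]
      rw [this, eq_neg_of_add_eq_zero_right hg]
      simp only [mul_smul, neg_smul, smul_neg, smul_add, neg_add]
      rfl
  · right
    refine ⟨fun i => -(g 4)⁻¹ * g (Fin.castLE (by norm_num) i), Or.inr
      ⟨-(g 4)⁻¹ * g 3, ?_⟩⟩
    have : x * y = (g 4)⁻¹ • (g 4 • (x * y)) := by
      rw [smul_smul, inv_mul_cancel₀ h4, one_smul]
    rw [sub_mul, this, eq_neg_of_add_eq_zero_right hg]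
    simp only [mul_smul, neg_smul, smul_neg, smul_add, neg_add, smul_mul_assoc, one_mul, neg_mul,
      sub_neg_eq_add, neg_add_cancel_right]
    rfl

/-- Pairs `(x, y)` such that `1`, `x`, `x ^ 2`, `y`, `x * y` lie in a proper subspace. -/
def degeneratePairs (p : ℕ) [Fact p.Prime] (B : Type*) [CommRing B] [Algebra (ZMod p) B] :
    Set (B × B) :=
  {w | ∃ V : Submodule (ZMod p) B, V ≠ ⊤ ∧ 1 ∈ V ∧ w.1 ∈ V ∧ w.1 ^ 2 ∈ V ∧ w.2 ∈ V ∧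
    w.1 * w.2 ∈ V}

variable [IsReduced B]

lemma card_degeneratePairs_le (hB : Nat.card B = p ^ 5) :
    Nat.card (degeneratePairs p B) ≤ 5 ^ 6 * p ^ 9 := by
  have hp : p.Prime := Fact.out
  let T := {x : B // (minpoly (ZMod p) x).natDegree ≤ 2}
  let val (c : Fin 3 → ZMod p) (x : B) : B := c 0 • 1 + c 1 • x + c 2 • x ^ 2
  let Z := {w : B × B // w.1 * w.2 = 0}
  have hsol (t : ZMod p) (c : Fin 3 → ZMod p) :
      Nat.card {w : B × B // (w.1 - t • 1) * w.2 = val c w.1} ≤ Nat.card Z := by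
    have hch (x : B) : ∃ y₀ : B, ∀ y, (x - t • 1) * y = val c x → (x - t • 1) * y₀ = val c x := by
      by_cases h : ∃ y, (x - t • 1) * y = val c x
      · obtain ⟨y, hy⟩ := h
        exact ⟨y, fun _ _ => hy⟩
      · push Not at h
        exact ⟨0, fun y hy => (h y hy).elim⟩
    choose y₀ hy₀ using hch
    refine Nat.card_le_card_of_injective
      (fun w => ⟨(w.1.1 - t • 1, w.1.2 - y₀ w.1.1), ?_⟩) ?_
    · simp only [mul_sub, hy₀ _ _ w.2, w.2, sub_self]
    · rintro ⟨⟨x, y⟩, h⟩ ⟨⟨x', y'⟩, h'⟩ hw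
      have hw := Prod.mk.inj (congrArg Subtype.val hw)
      simp only [sub_left_inj] at hw
      obtain ⟨rfl, hw⟩ := hw
      rw [sub_left_inj] at hw
      subst hw
      rfl
  let S1 : Set (B × B) := {w | (minpoly (ZMod p) w.1).natDegree ≤ 2}
  let S2 : Set (B × B) := ⋃ c : Fin 3 → ZMod p, {w | w.2 = val c w.1}
  let S3 : Set (B × B) := ⋃ d : ZMod p × (Fin 3 → ZMod p), {w | (w.1 - d.1 • 1) * w.2 = val d.2 w.1}
  have hS1 : S1.ncard ≤ 5 ^ 5 * p ^ 2 * p ^ 5 := by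
    have e : S1 = {x : B | (minpoly (ZMod p) x).natDegree ≤ 2} ×ˢ Set.univ := by
      ext w; simp [S1]
    rw [e, Set.ncard_prod, Set.ncard_univ, hB]
    exact Nat.mul_le_mul_right _ (card_natDegree_minpoly_le hB (by norm_num))
  have hS2 : S2.ncard ≤ p ^ 3 * p ^ 5 := by
    refine (Set.ncard_iUnion_le_of_fintype _).trans ?_
    refine (Finset.sum_le_card_nsmul _ _ (p ^ 5) fun c _ => ?_).trans_eq ?_
    · rw [← hB, ← Nat.card_coe_set_eq]
      refine Nat.card_le_card_of_injective (fun w => w.1.1) ?_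
      rintro ⟨⟨x, y⟩, h⟩ ⟨⟨x', y'⟩, h'⟩ (rfl : x = x')
      have e : y = y' := Eq.trans h (Eq.symm h')
      subst e
      rfl
    · simp
  have hS3 : S3.ncard ≤ p ^ 4 * (2 ^ 5 * p ^ 5) := by
    refine (Set.ncard_iUnion_le_of_fintype _).trans ?_
    refine (Finset.sum_le_card_nsmul _ _ (2 ^ 5 * p ^ 5) fun d _ => ?_).trans_eq ?_
    · exact (hsol d.1 d.2).trans (card_mul_eq_zero_le hB)
    · simp only [Finset.card_univ, Fintype.card_prod, ZMod.card, Fintype.card_pi,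
        Finset.prod_const, Fintype.card_fin, smul_eq_mul]
      ring
  have hsub : degeneratePairs p B ⊆ S1 ∪ S2 ∪ S3 := by
    rintro ⟨x, y⟩ ⟨V, hV, h1, hx, hxx, hy, hxy⟩
    rcases exists_relation_of_mem_proper hB hV h1 hx hxx hy hxy with h | ⟨c, h | ⟨t, h⟩⟩
    · exact Or.inl (Or.inl h)
    · exact Or.inl (Or.inr (Set.mem_iUnion.2 ⟨c, h⟩))
    · exact Or.inr (Set.mem_iUnion.2 ⟨(t, c), h⟩)
  have hfinal := (Set.ncard_le_ncard hsub (Set.toFinite _)).trans ((Set.ncard_union_le _ _).trans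
    (Nat.add_le_add_right (Set.ncard_union_le _ _) _))
  have hp1 : 1 ≤ p := hp.one_le
  have hp2 : 1 ≤ p ^ 2 := Nat.one_le_pow _ _ hp.pos
  refine hfinal.trans ?_
  have e1 : 5 ^ 5 * p ^ 2 * p ^ 5 ≤ 5 ^ 5 * p ^ 9 := by
    rw [mul_assoc, ← pow_add]
    exact Nat.mul_le_mul_left _ (Nat.pow_le_pow_right hp.pos (by norm_num))
  have e2 : p ^ 3 * p ^ 5 ≤ p ^ 9 := by
    rw [← pow_add]
    exact Nat.pow_le_pow_right hp.pos (by norm_num)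
  have e3 : p ^ 4 * (2 ^ 5 * p ^ 5) = 2 ^ 5 * p ^ 9 := by ring
  omega

end DegeneratePairs

section Degenerate

lemma card_fin_two_preimage_mul_le {G B : Type*} [AddCommGroup G] [AddCommGroup B] [Finite G]
    (ρ : G →+ B) (hρ : Function.Surjective ρ) (D : Set (B × B)) [Finite D] :
    Nat.card {x : Fin 2 → G // (ρ (x 0), ρ (x 1)) ∈ D} * Nat.card B ^ 2 ≤
      Nat.card D * Nat.card G ^ 2 := by
  choose s hs using hρ
  have hker : Nat.card ρ.ker * Nat.card B = Nat.card G := by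
    rw [← AddSubgroup.card_mul_index ρ.ker, AddSubgroup.index_ker,
      AddMonoidHom.range_eq_top.2 fun b => ⟨s b, hs b⟩]
    simp
  have hmem (g : G) : g - s (ρ g) ∈ ρ.ker := by
    rw [AddMonoidHom.mem_ker, map_sub, hs, sub_self]
  have h1 : Nat.card {x : Fin 2 → G // (ρ (x 0), ρ (x 1)) ∈ D} ≤
      Nat.card (D × (ρ.ker × ρ.ker)) := by
    refine Nat.card_le_card_of_injective
      (fun x => (⟨_, x.2⟩, (⟨_, hmem (x.1 0)⟩, ⟨_, hmem (x.1 1)⟩))) ?_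
    rintro ⟨x, hx⟩ ⟨y, hy⟩ h
    simp only [Prod.mk.injEq, Subtype.mk.injEq] at h
    obtain ⟨⟨h0, h1⟩, h2, h3⟩ := h
    rw [h0] at h2
    rw [h1] at h3
    refine Subtype.ext (funext fun i => ?_)
    fin_cases i
    · exact sub_left_injective h2
    · exact sub_left_injective h3
  rw [Nat.card_prod, Nat.card_prod] at h1
  calc _ ≤ Nat.card D * (Nat.card ρ.ker * Nat.card ρ.ker) * Nat.card B ^ 2 :=
        Nat.mul_le_mul_right _ h1
    _ = Nat.card D * (Nat.card ρ.ker * Nat.card B) ^ 2 := by ring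
    _ = _ := by rw [hker]

variable {A : Type*} [CommRing A] {p : ℕ} [Fact p.Prime] (hA : (multiples A p).index = p ^ 5)
  {B : Type*} [CommRing B] [Algebra (ZMod p) B] [Finite B] [IsReduced B]

omit [Finite B] [IsReduced B] in
lemma mem_degeneratePairs {ψ : A →+* B} (hker : ∀ x, ψ x = 0 ↔ x ∈ multiples A p) {O : Subring A}
    (h2 : codim p O.toAddSubgroup 2 ≠ 0) {y z : A} (hy : y ∈ layer p O.toAddSubgroup 1)
    (hz : z ∈ layer p O.toAddSubgroup 1) : (ψ y, ψ z) ∈ degeneratePairs p B := by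
  have hmul {u v : A} (hu : u ∈ layer p O.toAddSubgroup 1) (hv : v ∈ layer p O.toAddSubgroup 1) :
      u * v ∈ layer p O.toAddSubgroup 2 := mul_mem_layer (i := 1) (j := 1) hu hv
  have hlayer := layer_le_layer (p := p) O.toAddSubgroup (show 1 ≤ 2 by norm_num)
  have hmem {x : A} (hx : x ∈ layer p O.toAddSubgroup 2) : ψ x ∈ AddSubgroup.toZModSubmodule p
      ((layer p O.toAddSubgroup 2).map ψ.toAddMonoidHom) := ⟨x, hx, rfl⟩
  refine ⟨AddSubgroup.toZModSubmodule p ((layer p O.toAddSubgroup 2).map ψ.toAddMonoidHom),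
    fun htop => h2 ?_, ?_, hmem (hlayer hy), ?_, hmem (hlayer hz), ?_⟩
  · refine codim_eq_zero (eq_top_iff.2 fun x _ => ?_)
    have hx : ψ x ∈ AddSubgroup.toZModSubmodule p
      ((layer p O.toAddSubgroup 2).map ψ.toAddMonoidHom) := by rw [htop]; trivial
    obtain ⟨w, hw, hwx⟩ := hx
    have hwx : ψ w = ψ x := hwx
    have hsub : x - w ∈ layer p O.toAddSubgroup 2 :=
      multiples_le_layer _ _ ((hker _).1 (by rw [map_sub, hwx, sub_self]))
    simpa using add_mem hsub hw
  · rw [← map_one ψ]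
    exact hmem (one_mem_layer O 2)
  · rw [← map_pow, pow_two]
    exact hmem (hmul hy hy)
  · rw [← map_mul]
    exact hmem (hmul hy hz)

include hA in
lemma IsFamily.card_mul_le_of_surjective (hB : Nat.card B = p ^ 5) {ψ : A →+* B}
    (hψ : Function.Surjective ψ) (hker : ∀ x, ψ x = 0 ↔ x ∈ multiples A p)
    {N : ℕ} (hN : N ≠ 0) {a : ℕ → ℕ} {F : Set (Subring A)} (hF : IsFamily p N a F)
    (h01 : a 0 - a 1 = 2) (h12 : a 1 = a 2 + 1) (h2 : a 2 ≠ 0) :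
    Nat.card F * p ≤ 2 ^ 2 * p ^ (2 * (a 1 + a 2 + a 3)) * 5 ^ 6 := by
  have hp : p.Prime := Fact.out
  have := finite_quotient_powMultiples hp hA N
  set G := A ⧸ powMultiples A p N
  let ρ : G →+ B := QuotientAddGroup.lift (powMultiples A p N) ψ.toAddMonoidHom (by
    rintro _ ⟨x, rfl⟩
    refine (hker _).2 ?_
    obtain ⟨M, rfl⟩ := Nat.exists_eq_succ_of_ne_zero hN
    rw [AddMonoidHom.coe_mulLeft, pow_succ', mul_assoc]
    exact mul_mem_multiples _)
  have hρmk (x : A) : ρ (QuotientAddGroup.mk' (powMultiples A p N) x) = ψ x := rfl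
  have hρ : Function.Surjective ρ := fun b => by
    obtain ⟨x, rfl⟩ := hψ b
    exact ⟨_, hρmk x⟩
  have hD := card_degeneratePairs_le hB
  let Y : Set (Fin 2 → G) := {x | (ρ (x 0), ρ (x 1)) ∈ degeneratePairs p B}
  have hY : Nat.card Y * Nat.card B ^ 2 ≤ Nat.card (degeneratePairs p B) * Nat.card G ^ 2 :=
    card_fin_two_preimage_mul_le ρ hρ (degeneratePairs p B)
  have hmain := hF.card_mul_le hp hA (Or.inr h12) h01 Y ?_
  · have hG : 0 < Nat.card G ^ 2 := pow_pos Nat.card_pos _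
    rw [hB] at hY
    have hpp : 0 < p ^ 9 := pow_pos hp.pos _
    refine Nat.le_of_mul_le_mul_right (c := Nat.card G ^ 2 * p ^ 9) ?_ (Nat.mul_pos hG hpp)
    calc Nat.card F * p * (Nat.card G ^ 2 * p ^ 9)
        = Nat.card F * Nat.card G ^ 2 * (p ^ 5) ^ 2 := by ring
      _ ≤ 2 ^ 2 * p ^ (2 * (a 1 + a 2 + a 3)) * Nat.card Y * (p ^ 5) ^ 2 :=
        Nat.mul_le_mul_right _ hmain
      _ = 2 ^ 2 * p ^ (2 * (a 1 + a 2 + a 3)) * (Nat.card Y * (p ^ 5) ^ 2) := by ring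
      _ ≤ 2 ^ 2 * p ^ (2 * (a 1 + a 2 + a 3)) * (5 ^ 6 * p ^ 9 * Nat.card G ^ 2) :=
        Nat.mul_le_mul_left _ (hY.trans (Nat.mul_le_mul_right _ hD))
      _ = _ := by ring
  · intro O hO x hx
    choose y hy using fun i => QuotientAddGroup.mk'_surjective (powMultiples A p N) (x i)
    obtain rfl : (fun i => QuotientAddGroup.mk' (powMultiples A p N) (y i)) = x := funext hy
    have hgt := mem_genTuples_of_comp (powMultiples_le_inf (hF.pow_mem O hO) 0) inf_le_left hx
    exact mem_degeneratePairs hker (by rwa [hF.codim_eq O hO 2])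
      (level_le_layer _ _ (hgt.1 0)) (level_le_layer _ _ (hgt.1 1))

end Degenerate

/-- A prime `p` at which the rank five ring `R` is torsion free and unramified, and which is
not too small. -/
structure GoodPrime (R : Type*) [CommRing R] (p : ℕ) : Prop where
  prime : p.Prime
  large : 2 * 5 ^ 5 ≤ p
  eq_zero_of_mul : ∀ x : R, (p : R) * x = 0 → x = 0
  index_multiples : (multiples R p).index = p ^ 5
  dvd_of_dvd_sq : ∀ x : R, (p : R) ∣ x ^ 2 → (p : R) ∣ x

/-- The subring generated by all `x` with `p * x ∈ O`. -/
def up {R : Type*} [CommRing R] (p : ℕ) (O : Subring R) : Subring R :=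
  Subring.closure {x | (p : R) * x ∈ O}

section Up

variable {R : Type*} [CommRing R] {p : ℕ}

lemma mem_up_of_mul_mem {O : Subring R} {x : R} (hx : (p : R) * x ∈ O) : x ∈ up p O :=
  Subring.subset_closure hx

lemma le_up (O : Subring R) : O ≤ up p O := fun _ hx =>
  mem_up_of_mul_mem (O.mul_mem (natCast_mem O p) hx)

lemma pow_mul_mem_of_index {O : Subring R} {i : ℕ} (h : O.toAddSubgroup.index = p ^ i) (x : R) :
    (p : R) ^ i * x ∈ O := by
  have := AddSubgroup.nsmul_index_mem O.toAddSubgroup x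
  rw [h, nsmul_eq_mul, Nat.cast_pow] at this
  exact this

lemma up_ne_self {O : Subring R} {i : ℕ} (h : O.toAddSubgroup.index = p ^ i) (hO : O ≠ ⊤) :
    up p O ≠ O := by
  classical
  intro hup
  apply hO
  rw [eq_top_iff]
  intro x _
  have key : ∀ k : ℕ, (p : R) ^ k * x ∈ O → x ∈ O := by
    intro k
    induction k with
    | zero => intro hk; simpa using hk
    | succ k ih =>
      intro hk
      refine ih ?_
      rw [← hup]
      refine mem_up_of_mul_mem ?_
      rwa [← mul_assoc, ← pow_succ']
  exact key i (pow_mul_mem_of_index h x)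

lemma index_multiples_subring (hR : GoodPrime R p) {T : Subring R} {k : ℕ}
    (hT : T.toAddSubgroup.index = p ^ k) : (multiples T p).index = p ^ 5 := by
  have hpos : 0 < p ^ k := pow_pos hR.prime.pos _
  let μ : R →+ R := AddMonoidHom.mulLeft (p : R)
  have hμ : Function.Injective μ := by
    rw [injective_iff_map_eq_zero]
    exact hR.eq_zero_of_mul
  have h1 : (T.toAddSubgroup.map μ).index = p ^ 5 * p ^ k := by
    have hle : T.toAddSubgroup.map μ ≤ (⊤ : AddSubgroup R).map μ := AddSubgroup.map_mono le_top
    rw [← AddSubgroup.relIndex_mul_index hle, AddSubgroup.relIndex_map_map_of_injective _ _ hμ,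
      AddSubgroup.relIndex_top_right, hT, ← AddMonoidHom.range_eq_map, mul_comm]
    congr 1
    exact hR.index_multiples
  have hle : T.toAddSubgroup.map μ ≤ T.toAddSubgroup := by
    rintro _ ⟨x, hx, rfl⟩
    exact T.mul_mem (natCast_mem T p) hx
  rw [← AddSubgroup.relIndex_mul_index hle, hT] at h1
  rw [← Nat.eq_of_mul_eq_mul_right hpos h1, AddSubgroup.relIndex]
  congr 1
  ext x
  rw [AddSubgroup.mem_addSubgroupOf, mem_multiples]
  constructor
  · rintro ⟨y, rfl⟩
    exact ⟨y, y.2, by simp [μ]⟩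
  · rintro ⟨y, hy, hxy⟩
    exact ⟨⟨y, hy⟩, Subtype.ext (by simpa [μ] using hxy)⟩

lemma closure_layer_comap {O T : Subring R} (hT : up p O = T) :
    Subring.closure (layer p (O.comap T.subtype).toAddSubgroup 1 : Set T) = ⊤ := by
  have h1 : Subring.closure (level p (O.comap T.subtype).toAddSubgroup 1 : Set T) = ⊤ := by
    have hinj : Function.Injective T.subtype := Subtype.val_injective
    refine Function.LeftInverse.injective (g := Subring.comap T.subtype)
      (fun U => Subring.comap_map_eq_self_of_injective hinj U) ?_
    rw [RingHom.map_closure, ← RingHom.range_eq_map, Subring.range_subtype]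
    conv_rhs => rw [← hT, up]
    congr 1
    ext x
    constructor
    · rintro ⟨y, hy, rfl⟩
      have hy' : T.subtype ((p : T) ^ 1 * y) ∈ O := hy
      simpa using hy'
    · intro hx
      refine ⟨⟨x, hT ▸ mem_up_of_mul_mem hx⟩, ?_, rfl⟩
      change T.subtype ((p : T) ^ 1 * _) ∈ O
      simpa using hx
  rw [eq_top_iff, ← h1]
  exact Subring.closure_mono (level_le_layer _ 1)

end Up

section Residue

variable {R : Type*} [CommRing R] {p : ℕ}

/-- The residue ring `R / pR`. -/
abbrev Residue (R : Type*) [CommRing R] (p : ℕ) : Type _ := R ⧸ Ideal.span {(p : R)}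

lemma residue_eq_zero {x : R} :
    Ideal.Quotient.mk (Ideal.span {(p : R)}) x = 0 ↔ x ∈ multiples R p := by
  rw [Ideal.Quotient.eq_zero_iff_mem, Ideal.mem_span_singleton', mem_multiples]
  simp only [mul_comm]

variable (hR : GoodPrime R p)
include hR

lemma card_residue : Nat.card (Residue R p) = p ^ 5 := by
  rw [← hR.index_multiples]
  have : multiples R p = (Ideal.span {(p : R)}).toAddSubgroup := by
    ext x
    rw [← residue_eq_zero, Ideal.Quotient.eq_zero_iff_mem]
    rfl
  rw [this]
  rfl

lemma finite_residue : Finite (Residue R p) :=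
  Nat.finite_of_card_ne_zero (by rw [card_residue hR]; exact pow_ne_zero _ hR.prime.ne_zero)

lemma charP_residue : CharP (Residue R p) p := by
  have := finite_residue hR
  have : Nontrivial (Residue R p) := by
    rw [← Finite.one_lt_card_iff_nontrivial, card_residue hR]
    exact Nat.one_lt_pow (by norm_num) hR.prime.one_lt
  rw [CharP.charP_iff_prime_eq_zero hR.prime]
  have h := (residue_eq_zero (R := R) (p := p)).2 ⟨1, mul_one _⟩
  simpa using h

lemma isReduced_residue : IsReduced (Residue R p) := by
  rw [isReduced_iff_pow_one_lt 2 (by norm_num)]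
  intro x hx
  obtain ⟨x, rfl⟩ := Ideal.Quotient.mk_surjective x
  rw [← map_pow, Ideal.Quotient.eq_zero_iff_dvd] at hx
  exact Ideal.Quotient.eq_zero_iff_dvd _ _ |>.2 (hR.dvd_of_dvd_sq x hx)

/-- A high power map is the identity on a given residue class. -/
lemma exists_pow_sub_mem (N : ℕ) (x : R) :
    ∃ k, N ≤ k ∧ x ^ p ^ k - x ∈ multiples R p := by
  have := finite_residue hR
  have := charP_residue hR
  have := isReduced_residue hR
  have : Fact p.Prime := ⟨hR.prime⟩
  have hinj := frobenius_inj (Residue R p) p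
  obtain ⟨m, hm, hper⟩ := hinj.mem_periodicPts (Ideal.Quotient.mk (Ideal.span {(p : R)}) x)
  refine ⟨m * N, Nat.le_mul_of_pos_left N hm, ?_⟩
  rw [← residue_eq_zero, map_sub, map_pow, ← iterate_frobenius, sub_eq_zero]
  exact hper.mul_const N

lemma layer_zero_le_of_map_eq {O O' T : Subring R} {N : ℕ} (hT : up p O = T)
    (hN' : ∀ x : R, (p : R) ^ N * x ∈ O')
    (hmap : O.map (Ideal.Quotient.mk (Ideal.span {(p : R)})) =
      O'.map (Ideal.Quotient.mk (Ideal.span {(p : R)}))) :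
    layer p (O.comap T.subtype).toAddSubgroup 0 ≤
      layer p (O.comap T.subtype ⊓ O'.comap T.subtype).toAddSubgroup 0 := by
  refine sup_le ?_ (multiples_le_layer _ _)
  rw [level_zero]
  rintro ⟨o, hoT⟩ (ho : o ∈ O)
  have hmem : Ideal.Quotient.mk (Ideal.span {(p : R)}) o ∈
      O'.map (Ideal.Quotient.mk (Ideal.span {(p : R)})) := hmap ▸ ⟨o, ho, rfl⟩
  obtain ⟨o', ho', hoo'⟩ := hmem
  have hdvd : (p : R) ∣ o - o' := by
    rw [← Ideal.Quotient.eq_zero_iff_dvd, map_sub, hoo', sub_self]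
  obtain ⟨k, hk, r, hr⟩ := exists_pow_sub_mem hR N o
  have hr : (p : R) * r = o ^ p ^ k - o := hr
  obtain ⟨s, hs⟩ := dvd_sub_pow_of_dvd_sub hdvd k
  have hpow' : o ^ p ^ k ∈ O' := by
    have h1 : o ^ p ^ k = (p : R) ^ N * ((p : R) ^ (k + 1 - N) * s) + o' ^ p ^ k := by
      rw [← mul_assoc, ← pow_add, Nat.add_sub_cancel' (by omega : N ≤ k + 1)]
      linear_combination hs
    rw [h1]
    exact O'.add_mem (hN' _) (O'.pow_mem ho' _)
  have hpow : o ^ p ^ k ∈ O := O.pow_mem ho _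
  have hrT : r ∈ T := by
    rw [← hT]
    refine mem_up_of_mul_mem ?_
    rw [hr]
    exact O.sub_mem hpow ho
  refine mem_layer.2 ⟨⟨o, hoT⟩ ^ p ^ k, ?_, -⟨r, hrT⟩, Subtype.ext ?_⟩
  · rw [level_zero]
    exact ⟨hpow, hpow'⟩
  · simp only [Subring.coe_add, Subring.coe_mul, Subring.coe_neg, Subring.coe_natCast,
      Subring.coe_pow]
    linear_combination hr

end Residue

section Exponents

lemma exponent_bounds {a b c d : ℕ} (ha : a < 5) (hab : b < a ∨ a = 0 ∧ b = 0)
    (hbc : c < b ∨ b = 0 ∧ c = 0) (hcd : d < c ∨ c = 0 ∧ d = 0) (hcase : c = 0 ∨ b = c + 1) :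
    a - b ≤ 4 ∧ (a - b) * (b + c + d) ≤ a + b + c + d - 1 ∧
      ((a - b) * (b + c + d) ≤ a + b + c + d - 2 ∨ a = 4 ∧ b = 2 ∧ c = 1 ∧ d = 0) := by
  have hb : b ≤ a := by omega
  have hc : c ≤ b := by omega
  have hd : d ≤ c := by omega
  interval_cases a <;> interval_cases b <;> interval_cases c <;> interval_cases d <;> simp_all

lemma exponent_bounds' {a b c d : ℕ} (ha : a < 5) (hab : b < a ∨ a = 0 ∧ b = 0)
    (hbc : c < b ∨ b = 0 ∧ c = 0) (hcd : d < c ∨ c = 0 ∧ d = 0)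
    (hcase : ¬ (c = 0 ∨ b = c + 1)) : a = 4 ∧ b = 3 ∧ c = 1 ∧ d = 0 := by
  omega

end Exponents

section Family

variable {A : Type*} [CommRing A] {p : ℕ} (hp : p.Prime) (hA : (multiples A p).index = p ^ 5)
  {N : ℕ} {a : ℕ → ℕ} {F : Set (Subring A)} (hF : IsFamily p N a F)
include hp hA hF

lemma IsFamily.exponents {O : Subring A} (hO : O ∈ F) :
    a 0 < 5 ∧ (a 1 < a 0 ∨ a 0 = 0 ∧ a 1 = 0) ∧ (a 2 < a 1 ∨ a 1 = 0 ∧ a 2 = 0) ∧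
      (a 3 < a 2 ∨ a 2 = 0 ∧ a 3 = 0) ∧ O.toAddSubgroup.index = p ^ (a 0 + a 1 + a 2 + a 3) := by
  have h0 := codim_zero_lt hp hA (by norm_num) O
  have h1 := codim_succ hp hA (hF.generates O hO) 0 1 rfl
  have h2 := codim_succ hp hA (hF.generates O hO) 1 2 rfl
  have h3 := codim_succ hp hA (hF.generates O hO) 2 3 rfl
  have h4 := index_level_of_generates hp hA (hF.pow_mem O hO) (hF.generates O hO)
    (j := 0) (k := 4) rfl
  simp only [hF.codim_eq O hO] at h0 h1 h2 h3 h4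
  refine ⟨h0, h1, h2, h3, ?_⟩
  rw [level_zero] at h4
  rw [h4]
  simp [Finset.sum_range_succ]

lemma IsFamily.card_le_of_index {c : ℕ} (hc : ∀ O ∈ F, O.toAddSubgroup.index = p ^ c) :
    Nat.card F ≤ 16 * p ^ (c - 1) ∧
      (Nat.card F ≤ 16 * p ^ (c - 2) ∨ (a 0 = 4 ∧ a 1 = 2 ∧ a 2 = 1 ∧ a 3 = 0 ∧ c = 7)) := by
  rcases F.eq_empty_or_nonempty with rfl | ⟨O, hO⟩
  · simp
  obtain ⟨h0, h1, h2, h3, h4⟩ := hF.exponents hp hA hO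
  have hc : c = a 0 + a 1 + a 2 + a 3 := by
    rw [hc O hO] at h4
    exact Nat.pow_right_injective hp.two_le h4
  by_cases hcase : a 2 = 0 ∨ a 1 = a 2 + 1
  · obtain ⟨e1, e2, e3⟩ := exponent_bounds h0 h1 h2 h3 hcase
    have hcard := hF.card_le hp hA hcase
    have key : ∀ e, (a 0 - a 1) * (a 1 + a 2 + a 3) ≤ e → Nat.card F ≤ 16 * p ^ e := by
      intro e he
      refine hcard.trans (Nat.mul_le_mul ?_ (Nat.pow_le_pow_right hp.pos he))
      exact Nat.pow_le_pow_right (n := 2) (by norm_num) e1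
    rw [← hc] at e2 e3
    refine ⟨key _ e2, ?_⟩
    rcases e3 with e3 | e3
    · exact Or.inl (key _ e3)
    · right; omega
  · have h := exponent_bounds' h0 h1 h2 h3 hcase
    have hcard := hF.card_le' hp hA
    obtain ⟨e0, e1, e2, e3⟩ := h
    rw [e0, e1, e2, e3] at hcard hc
    subst hc
    norm_num at hcard ⊢
    have : p ^ 6 ≤ p ^ 7 := Nat.pow_le_pow_right hp.pos (by norm_num)
    omega

omit hF in
lemma IsFamily.card_le_of_index_of_surjective {B : Type*} [CommRing B] [Algebra (ZMod p) B]
    [Finite B] [IsReduced B] (hB : Nat.card B = p ^ 5) {ψ : A →+* B}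
    (hψ : Function.Surjective ψ) (hker : ∀ x, ψ x = 0 ↔ x ∈ multiples A p)
    (hN : N ≠ 0) (hF : IsFamily p N a F) {c : ℕ}
    (hc : ∀ O ∈ F, O.toAddSubgroup.index = p ^ c) :
    Nat.card F ≤ 4 * 5 ^ 6 * p ^ (c - 2) := by
  have : Fact p.Prime := ⟨hp⟩
  rcases (hF.card_le_of_index hp hA hc).2 with h | ⟨h0, h1, h2, h3, h4⟩
  · exact h.trans (Nat.mul_le_mul_right _ (by norm_num))
  · have h := hF.card_mul_le_of_surjective hA hB hψ hker hN (by omega) (by omega) (by omega)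
    rw [h1, h2, h3] at h
    subst h4
    refine Nat.le_of_mul_le_mul_right (h.trans_eq ?_) hp.pos
    norm_num
    ring

end Family

section Children

variable {R : Type*} [CommRing R] {p : ℕ}

/-- The subrings `O` with `up p O = T` having index `p ^ c` in `T`. -/
def children (p : ℕ) (T : Subring R) (c : ℕ) : Set (Subring R) :=
  {O | up p O = T ∧ O.toAddSubgroup.relIndex T.toAddSubgroup = p ^ c}

lemma comap_subtype_injOn_children (T : Subring R) (c : ℕ) :
    Set.InjOn (fun O : Subring R => O.comap T.subtype) (children p T c) := by
  rintro O ⟨hO, -⟩ O' ⟨hO', -⟩ h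
  have key : ∀ O : Subring R, up p O = T → ∀ x, x ∈ O ↔ ∃ hx : x ∈ T, (⟨x, hx⟩ : T) ∈
      O.comap T.subtype := fun O hO x =>
    ⟨fun hx => ⟨hO ▸ le_up O hx, hx⟩, fun ⟨_, hx⟩ => hx⟩
  ext x
  simp only at h
  rw [key O hO, key O' hO', h]

lemma index_comap_subtype (O T : Subring R) : (O.comap T.subtype).toAddSubgroup.index =
    O.toAddSubgroup.relIndex T.toAddSubgroup := rfl

/-- The codimensions of the layers, as elements of `Fin 5`. -/
noncomputable def shape (p : ℕ) (T O : Subring R) (j : Fin 4) : Fin 5 :=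
  Fin.ofNat 5 (codim p (O.comap T.subtype).toAddSubgroup j)

variable (hR : GoodPrime R p) {T : Subring R} {k : ℕ} (hT : T.toAddSubgroup.index = p ^ k)
include hR hT

lemma codim_lt_five (O : Subring R) (j : ℕ) :
    codim p (O.comap T.subtype).toAddSubgroup j < 5 :=
  (codim_anti_right hR.prime (index_multiples_subring hR hT) _ (Nat.zero_le j)).trans_lt
    (codim_zero_lt hR.prime (index_multiples_subring hR hT) (by norm_num) _)

lemma shape_val (O : Subring R) (j : Fin 4) :
    (shape p T O j : ℕ) = codim p (O.comap T.subtype).toAddSubgroup j :=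
  Nat.mod_eq_of_lt (codim_lt_five hR hT O j)

lemma isFamily_children (c : ℕ) (U : Subring (Residue R p)) (s : Fin 4 → Fin 5) :
    IsFamily p (c + k) (fun j => if h : j < 4 then (s ⟨j, h⟩ : ℕ) else 0)
      ((fun O : Subring R => O.comap T.subtype) '' {O ∈ children p T c |
        O.map (Ideal.Quotient.mk (Ideal.span {(p : R)})) = U ∧ shape p T O = s}) := by
  have hA := index_multiples_subring hR hT
  have hpow : ∀ O ∈ children p T c, ∀ x : R, (p : R) ^ (c + k) * x ∈ O := by
    rintro O ⟨hO, hOc⟩ x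
    refine pow_mul_mem_of_index ?_ x
    rw [← AddSubgroup.relIndex_mul_index (show O.toAddSubgroup ≤ T.toAddSubgroup from
      hO ▸ le_up O), hOc, hT, pow_add]
  constructor
  · rintro _ ⟨O, ⟨hO, -⟩, rfl⟩ x
    have := hpow O hO x
    simpa using this
  · rintro _ ⟨O, ⟨hO, -⟩, rfl⟩
    exact closure_layer_comap hO.1
  · rintro _ ⟨O, ⟨hO, -, rfl⟩, rfl⟩ j
    by_cases hj : j < 4
    · simp only [hj, dif_pos, shape_val hR hT]
    · simp only [hj, dif_neg, not_false_eq_true]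
      have h4 := codim_four_eq_zero hR.prime hA (closure_layer_comap hO.1)
      have := codim_anti_right hR.prime hA (O.comap T.subtype).toAddSubgroup (not_lt.1 hj)
      omega
  · rintro _ ⟨O, ⟨hO, hU, -⟩, rfl⟩ _ ⟨O', ⟨hO', hU', -⟩, rfl⟩
    exact layer_zero_le_of_map_eq hR hO.1 (hpow O' hO') (hU.trans hU'.symm)

omit hT in
lemma ncard_le_of_fibers {X : Set (Subring R)} (g : Subring R → Fin 4 → Fin 5) {B : ℕ}
    (hB : ∀ (U : Subring (Residue R p)) (s : Fin 4 → Fin 5), {O ∈ X |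
      O.map (Ideal.Quotient.mk (Ideal.span {(p : R)})) = U ∧ g O = s}.ncard ≤ B) :
    X.ncard ≤ 12 * 5 ^ 5 * 5 ^ 4 * B := by
  have := finite_residue hR
  have := charP_residue hR
  have := isReduced_residue hR
  have : Fact p.Prime := ⟨hR.prime⟩
  let _ : Algebra (ZMod p) (Residue R p) := ZMod.algebra _ p
  have hsub := card_subring_le (card_residue hR) hR.large
  have hfin : Finite (Subring (Residue R p)) :=
    Finite.of_injective (β := Set (Residue R p)) _ SetLike.coe_injective
  have := Fintype.ofFinite (Subring (Residue R p))
  have hX : X = ⋃ q ∈ (Finset.univ : Finset (Subring (Residue R p) × (Fin 4 → Fin 5))),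
      {O ∈ X | O.map (Ideal.Quotient.mk (Ideal.span {(p : R)})) = q.1 ∧ g O = q.2} := by
    ext O
    simp
  rw [hX]
  refine (Finset.set_ncard_biUnion_le _ _).trans ?_
  refine (Finset.sum_le_card_nsmul _ _ B fun q _ => hB q.1 q.2).trans ?_
  rw [Finset.card_univ, Fintype.card_prod, smul_eq_mul, ← Nat.card_eq_fintype_card]
  refine Nat.mul_le_mul_right _ (Nat.mul_le_mul hsub ?_)
  simp

omit hR hT in
lemma ncard_fiber_eq (c : ℕ) (P : Subring R → Prop) :
    {O ∈ children p T c | P O}.ncard =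
      Nat.card ((fun O : Subring R => O.comap T.subtype) '' {O ∈ children p T c | P O}) := by
  rw [Nat.card_coe_set_eq, Set.InjOn.ncard_image]
  exact (comap_subtype_injOn_children T c).mono (Set.sep_subset _ _)

lemma ncard_children_le (c : ℕ) :
    (children p T c).ncard ≤ 12 * 5 ^ 5 * 5 ^ 4 * (16 * p ^ (c - 1)) := by
  refine ncard_le_of_fibers hR (shape p T) fun U s => ?_
  rw [ncard_fiber_eq]
  refine ((isFamily_children hR hT c U s).card_le_of_index hR.prime
    (index_multiples_subring hR hT) ?_).1
  rintro _ ⟨O, ⟨hO, -⟩, rfl⟩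
  exact hO.2

omit hT in
lemma ncard_children_top_le {c : ℕ} (hc : c ≠ 0) :
    (children p (⊤ : Subring R) c).ncard ≤ 12 * 5 ^ 5 * 5 ^ 4 * (4 * 5 ^ 6 * p ^ (c - 2)) := by
  have hT : (⊤ : Subring R).toAddSubgroup.index = p ^ 0 := by
    rw [pow_zero, AddSubgroup.index_eq_one]
    rfl
  have := finite_residue hR
  have := charP_residue hR
  have := isReduced_residue hR
  let _ : Algebra (ZMod p) (Residue R p) := ZMod.algebra _ p
  refine ncard_le_of_fibers hR (shape p ⊤) fun U s => ?_
  rw [ncard_fiber_eq]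
  refine IsFamily.card_le_of_index_of_surjective hR.prime
    (index_multiples_subring hR hT) (card_residue hR)
    (ψ := (Ideal.Quotient.mk (Ideal.span {(p : R)})).comp (⊤ : Subring R).subtype)
    ?_ ?_ (by omega : c + 0 ≠ 0) (isFamily_children hR hT c U s) ?_
  · intro x
    obtain ⟨x, rfl⟩ := Ideal.Quotient.mk_surjective x
    exact ⟨⟨x, trivial⟩, rfl⟩
  · intro x
    refine (residue_eq_zero (R := R) (p := p)).trans ?_
    rw [mem_multiples, mem_multiples]
    exact ⟨fun ⟨y, hy⟩ => ⟨⟨y, trivial⟩, Subtype.ext hy⟩,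
      fun ⟨y, hy⟩ => ⟨y, congrArg Subtype.val hy⟩⟩
  · rintro _ ⟨O, ⟨hO, -⟩, rfl⟩
    exact hO.2

lemma le_ten_of_mem_children {c : ℕ} {O : Subring R} (hO : O ∈ children p T c) : c ≤ 10 := by
  obtain ⟨h0, h1, h2, h3, h4⟩ := (isFamily_children hR hT c _ _).exponents hR.prime
    (index_multiples_subring hR hT) ⟨O, ⟨hO, rfl, rfl⟩, rfl⟩
  rw [index_comap_subtype, hO.2] at h4
  have := Nat.pow_right_injective hR.prime.two_le h4
  omega

omit hT in
lemma finite_setOf_index_eq (i : ℕ) : {O : Subring R | O.toAddSubgroup.index = p ^ i}.Finite := by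
  have := finite_quotient_powMultiples hR.prime hR.index_multiples i
  refine Set.Finite.of_finite_image (f := fun O : Subring R =>
    (QuotientAddGroup.mk : R → R ⧸ powMultiples R p i) '' O) (Set.toFinite _) ?_
  have key : ∀ O O' : Subring R, O'.toAddSubgroup.index = p ^ i →
      (QuotientAddGroup.mk : R → R ⧸ powMultiples R p i) '' O ⊆
        (QuotientAddGroup.mk : R → R ⧸ powMultiples R p i) '' O' → O ≤ O' := by
    intro O O' hO' h x hx
    obtain ⟨y, hy, hxy⟩ := h ⟨x, hx, rfl⟩
    have := powMultiples_le_of_pow_mem (pow_mul_mem_of_index hO') (QuotientAddGroup.eq.1 hxy)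
    simpa using O'.add_mem hy this
  intro O hO O' hO' h
  exact le_antisymm (key O O' hO' h.le) (key O' O hO h.ge)

end Children

/-- The subrings of index `p ^ i`. -/
def subringsOfIndex (R : Type*) [CommRing R] (p i : ℕ) : Set (Subring R) :=
  {O | O.toAddSubgroup.index = p ^ i}

/-- A bound for the exponential growth rate of the number of subrings. -/
def growth : ℕ := 10 * (12 * 5 ^ 5 * 5 ^ 4 * (4 * 5 ^ 6))

section Recursion

variable {R : Type*} [CommRing R] {p : ℕ}

lemma subringsOfIndex_zero : subringsOfIndex R p 0 = {⊤} := by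
  ext O
  simp only [subringsOfIndex, Set.mem_ofPred_eq, pow_zero, AddSubgroup.index_eq_one,
    Set.mem_singleton_iff]
  rw [← Subring.toAddSubgroup_injective.eq_iff]
  rfl

lemma exists_mem_children (hp : p.Prime) {O : Subring R} {i : ℕ} (hi : i ≠ 0)
    (hO : O ∈ subringsOfIndex R p i) :
    ∃ c, 1 ≤ c ∧ c ≤ i ∧ up p O ∈ subringsOfIndex R p (i - c) ∧ O ∈ children p (up p O) c := by
  have hle : O.toAddSubgroup ≤ (up p O).toAddSubgroup := le_up O
  have hO : O.toAddSubgroup.index = p ^ i := hO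
  have hmul := AddSubgroup.relIndex_mul_index hle
  rw [hO] at hmul
  obtain ⟨c, hci, hc⟩ := (Nat.dvd_prime_pow hp).1 (Dvd.intro _ hmul)
  refine ⟨c, ?_, hci, ?_, rfl, hc⟩
  · by_contra! hc0
    obtain rfl : c = 0 := by omega
    rw [pow_zero, AddSubgroup.relIndex_eq_one] at hc
    refine up_ne_self hO ?_ (le_antisymm hc hle)
    rintro rfl
    have : (⊤ : Subring R).toAddSubgroup.index = 1 := AddSubgroup.index_top
    rw [this] at hO
    exact (Nat.one_lt_pow hi hp.one_lt).ne hO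
  · refine Nat.eq_of_mul_eq_mul_left (pow_pos hp.pos c) ?_
    rw [← pow_add, Nat.add_sub_cancel' hci, ← hmul, hc]

variable (hR : GoodPrime R p)
include hR

lemma subringsOfIndex_subset {i : ℕ} (hi : i ≠ 0) : subringsOfIndex R p i ⊆
    ⋃ c ∈ {c ∈ Finset.Icc 1 10 | c ≤ i}, ⋃ T ∈ (finite_setOf_index_eq hR (i - c)).toFinset,
      children p T c := by
  intro O hO
  obtain ⟨c, hc1, hci, hT, hc⟩ := exists_mem_children hR.prime hi hO
  simp only [Set.mem_iUnion, Finset.mem_filter, Finset.mem_Icc, Set.Finite.mem_toFinset]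
  exact ⟨c, ⟨⟨hc1, le_ten_of_mem_children hR hT hc⟩, hci⟩, up p O, hT, hc⟩

lemma ncard_subringsOfIndex_le_sum {i : ℕ} (hi : i ≠ 0) : (subringsOfIndex R p i).ncard ≤
    ∑ c ∈ Finset.Icc 1 10 with c ≤ i, ∑ T ∈ (finite_setOf_index_eq hR (i - c)).toFinset,
      (children p T c).ncard := by
  refine (Set.ncard_le_ncard (subringsOfIndex_subset hR hi) ?_).trans <|
    (Finset.set_ncard_biUnion_le _ _).trans <| Finset.sum_le_sum fun c _ =>
      Finset.set_ncard_biUnion_le _ _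
  refine Set.Finite.biUnion (Finset.finite_toSet _) fun c hc =>
    Set.Finite.biUnion (Finset.finite_toSet _) fun T hT => ?_
  rw [Finset.mem_coe, Set.Finite.mem_toFinset] at hT
  refine (finite_setOf_index_eq hR (c + (i - c))).subset fun O hO => ?_
  have hle : O.toAddSubgroup ≤ T.toAddSubgroup := hO.1 ▸ le_up O
  change _ = _
  rw [← AddSubgroup.relIndex_mul_index hle, hO.2, hT, pow_add]

lemma sum_ncard_children_le (j c : ℕ) :
    10 * ∑ T ∈ (finite_setOf_index_eq hR j).toFinset, (children p T c).ncard ≤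
      growth * (p ^ (c - 1) * (subringsOfIndex R p j).ncard) := by
  have h : ∀ T ∈ (finite_setOf_index_eq hR j).toFinset, (children p T c).ncard ≤
      12 * 5 ^ 5 * 5 ^ 4 * (16 * p ^ (c - 1)) := fun T hT => by
    rw [Set.Finite.mem_toFinset] at hT
    exact ncard_children_le hR hT c
  have h2 := Finset.sum_le_card_nsmul _ _ _ h
  rw [← Set.ncard_eq_toFinset_card _ (finite_setOf_index_eq hR j)] at h2
  have h3 : 10 * (12 * 5 ^ 5 * 5 ^ 4 * 16) ≤ growth := by decide
  calc _ ≤ _ := Nat.mul_le_mul_left _ h2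
    _ = 10 * (12 * 5 ^ 5 * 5 ^ 4 * 16) * (p ^ (c - 1) * (subringsOfIndex R p j).ncard) := by
      rw [smul_eq_mul, subringsOfIndex]; ring
    _ ≤ _ := Nat.mul_le_mul_right _ h3

lemma sum_ncard_children_zero_le {c : ℕ} (hc : c ≠ 0) :
    10 * ∑ T ∈ (finite_setOf_index_eq hR 0).toFinset, (children p T c).ncard ≤
      growth * p ^ (c - 2) := by
  have h : (finite_setOf_index_eq hR 0).toFinset = {⊤} := by
    ext T
    rw [Set.Finite.mem_toFinset, Finset.mem_singleton]
    exact (Set.ext_iff.1 (subringsOfIndex_zero (R := R) (p := p)) T)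
  rw [h, Finset.sum_singleton]
  calc _ ≤ _ := Nat.mul_le_mul_left _ (ncard_children_top_le hR hc)
    _ = _ := by rw [growth]; ring

theorem ncard_subringsOfIndex_le {i : ℕ} (hi : i ≠ 0) : ((subringsOfIndex R p i).ncard : ℝ) ≤
    (growth : ℝ) ^ i * (p : ℝ) ^ (max 0 (10 / 11 * (i : ℝ) - 1)) := by
  induction i using Nat.strong_induction_on with
  | _ i ih =>
  have hp1 : (1 : ℝ) ≤ p := by exact_mod_cast hR.prime.one_le
  have hp0 : (0 : ℝ) < p := by linarith
  have hg : (1 : ℝ) ≤ growth := by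
    have : 1 ≤ growth := by decide
    exact_mod_cast this
  have hterm : ∀ c ∈ ({c ∈ Finset.Icc 1 10 | c ≤ i} : Finset ℕ),
      ((10 * ∑ T ∈ (finite_setOf_index_eq hR (i - c)).toFinset, (children p T c).ncard : ℕ) : ℝ) ≤
        (growth : ℝ) ^ i * (p : ℝ) ^ (max 0 (10 / 11 * (i : ℝ) - 1)) := by
    intro c hc
    simp only [Finset.mem_filter, Finset.mem_Icc] at hc
    obtain ⟨⟨hc1, hc10⟩, hci⟩ := hc
    have hc10' : (c : ℝ) ≤ 10 := by exact_mod_cast hc10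
    rcases hci.eq_or_lt with rfl | hlt
    · have h := sum_ncard_children_zero_le hR hi
      rw [Nat.sub_self]
      refine (Nat.cast_le.2 h).trans ?_
      push_cast
      refine mul_le_mul (le_self_pow₀ hg hi) ?_ (by positivity) (by positivity)
      rw [← Real.rpow_natCast]
      refine Real.rpow_le_rpow_of_exponent_le hp1 ?_
      rcases Nat.lt_or_ge c 2 with h2 | h2
      · rw [Nat.sub_eq_zero_of_le h2.le]
        simp
      · refine le_max_of_le_right ?_
        rw [Nat.cast_sub h2]
        push_cast
        linarith
    · have hic : i - c ≠ 0 := by omega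
      have h := sum_ncard_children_le hR (i - c) c
      refine (Nat.cast_le.2 h).trans ?_
      push_cast
      have hI := ih (i - c) (by omega) hic
      have hexp : ((c - 1 : ℕ) : ℝ) + max 0 (10 / 11 * ((i - c : ℕ) : ℝ) - 1) ≤
          max 0 (10 / 11 * (i : ℝ) - 1) := by
        have hi2 : (c : ℝ) + 1 ≤ i := by exact_mod_cast hlt
        refine le_max_of_le_right ?_
        rw [Nat.cast_sub hc1, Nat.cast_sub hci]
        rcases (show i = c + 1 ∨ c + 2 ≤ i by omega) with rfl | h2
        · push_cast
          rw [max_eq_left (by linarith)]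
          linarith
        · have h2' : (c : ℝ) + 2 ≤ i := by exact_mod_cast h2
          push_cast
          rw [max_eq_right (by linarith)]
          linarith
      calc (growth : ℝ) * ((p : ℝ) ^ (c - 1) * (subringsOfIndex R p (i - c)).ncard)
          ≤ growth * ((p : ℝ) ^ (c - 1) * ((growth : ℝ) ^ (i - c) *
              (p : ℝ) ^ (max 0 (10 / 11 * ((i - c : ℕ) : ℝ) - 1)))) := by gcongr
        _ = (growth : ℝ) ^ (i - c + 1) *
              (p : ℝ) ^ (((c - 1 : ℕ) : ℝ) + max 0 (10 / 11 * ((i - c : ℕ) : ℝ) - 1)) := by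
            rw [Real.rpow_add hp0, Real.rpow_natCast]; ring
        _ ≤ _ := by
            refine mul_le_mul (pow_le_pow_right₀ hg (by omega))
              (Real.rpow_le_rpow_of_exponent_le hp1 hexp) (by positivity) (by positivity)
  have h1 : ((10 * (subringsOfIndex R p i).ncard : ℕ) : ℝ) ≤
      10 * ((growth : ℝ) ^ i * (p : ℝ) ^ (max 0 (10 / 11 * (i : ℝ) - 1))) := by
    refine (Nat.cast_le.2 (Nat.mul_le_mul_left 10 (ncard_subringsOfIndex_le_sum hR hi))).trans ?_
    rw [Finset.mul_sum, Nat.cast_sum]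
    refine (Finset.sum_le_card_nsmul _ _ _ hterm).trans ?_
    rw [nsmul_eq_mul]
    refine mul_le_mul_of_nonneg_right ?_ (by positivity)
    have : ({c ∈ Finset.Icc 1 10 | c ≤ i} : Finset ℕ).card ≤ 10 :=
      (Finset.card_filter_le _ _).trans (by simp)
    exact_mod_cast this
  push_cast at h1
  linarith

end Recursion

lemma dvd_of_dvd_sq_of_not_dvd_discr {K : Type*} [Field K] [NumberField K] {p : ℕ} (hp : p.Prime)
    (hd : ¬ (p : ℤ) ∣ discr K) {x : 𝓞 K} (hx : (p : 𝓞 K) ∣ x ^ 2) : (p : 𝓞 K) ∣ x := by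
  have hpZ : Prime (p : ℤ) := Nat.prime_iff_prime_int.1 hp
  have hmax : (Ideal.span {(p : ℤ)}).IsMaximal :=
    PrincipalIdealRing.isMaximal_of_irreducible hpZ.irreducible
  have hsq : Squarefree (Ideal.span {(p : 𝓞 K)}) := by
    intro P hP
    have hdiff : P ^ (2 - 1) ∣ differentIdeal ℤ (𝓞 K) := by
      refine pow_sub_one_dvd_differentIdeal ℤ (p := Ideal.span {(p : ℤ)}) P 2 ?_ ?_
      · simpa using hp.ne_zero
      · simpa [Ideal.map_span, pow_two] using hP
    have hP1 : (p : 𝓞 K) ∈ P := by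
      have := Ideal.dvd_iff_le.1 (dvd_of_mul_left_dvd hP)
      exact this (Ideal.mem_span_singleton_self _)
    have hP2 : ((discr K : ℤ) : 𝓞 K) ∈ P := by
      rw [show 2 - 1 = 1 from rfl, pow_one] at hdiff
      exact Ideal.dvd_iff_le.1 hdiff (discr_mem_differentIdeal K (𝓞 K))
    obtain ⟨u, v, huv⟩ := (hpZ.coprime_iff_not_dvd.2 hd)
    rw [Ideal.isUnit_iff, Ideal.eq_top_iff_one]
    have h1 : (1 : 𝓞 K) = (u : 𝓞 K) * (p : 𝓞 K) + (v : 𝓞 K) * ((discr K : ℤ) : 𝓞 K) := by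
      have := congrArg (Int.cast : ℤ → 𝓞 K) huv
      push_cast at this
      exact this.symm
    rw [h1]
    exact P.add_mem (P.mul_mem_left _ hP1) (P.mul_mem_left _ hP2)
  have h := hsq.dvd_pow_iff_dvd (y := Ideal.span {x}) (n := 2) (by norm_num)
  rw [Ideal.span_singleton_pow, Ideal.dvd_iff_le, Ideal.dvd_iff_le,
    Ideal.span_singleton_le_span_singleton, Ideal.span_singleton_le_span_singleton] at h
  exact h.1 hx

/-- The ring of integers of `K`, padded by copies of `ℤ` to a ring of rank five. -/
abbrev Padded (K : Type*) [Field K] [NumberField K] : Type _ := 𝓞 K × (Fin (5 - Module.finrank ℚ K) → ℤ)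

section NumberField

variable {K : Type*} [Field K] [NumberField K] (hdeg : Module.finrank ℚ K ≤ 5) {p : ℕ}
include hdeg

lemma goodPrime_padded (hp : p.Prime) (hlarge : 2 * 5 ^ 5 ≤ p) (hd : ¬ (p : ℤ) ∣ discr K) :
    GoodPrime (Padded K) p where
  prime := hp
  large := hlarge
  eq_zero_of_mul := by
    rintro ⟨x, y⟩ h
    have hp0 : (p : 𝓞 K) ≠ 0 := Nat.cast_ne_zero.2 hp.ne_zero
    have h1 : (p : 𝓞 K) * x = 0 := congrArg Prod.fst h
    have h2 : ∀ j, (p : ℤ) * y j = 0 := fun j => congrFun (congrArg Prod.snd h) j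
    refine Prod.ext ((mul_eq_zero.1 h1).resolve_left hp0) (funext fun j => ?_)
    exact (mul_eq_zero.1 (h2 j)).resolve_left (Nat.cast_ne_zero.2 hp.ne_zero)
  index_multiples := by
    have hfin : Module.finrank ℤ (Padded K) = 5 := by
      rw [Module.finrank_prod, RingOfIntegers.rank, Module.finrank_fin_fun]
      omega
    have h := AddSubgroup.index_range_nsmul (M := Padded K) p
    rw [hfin] at h
    rw [← h]
    congr 1
    ext x
    simp [mem_multiples]
  dvd_of_dvd_sq := by
    rintro ⟨x, y⟩ ⟨⟨u, v⟩, h⟩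
    have h1 : x ^ 2 = (p : 𝓞 K) * u := congrArg Prod.fst h
    have h2 : ∀ j, y j ^ 2 = (p : ℤ) * v j := fun j => congrFun (congrArg Prod.snd h) j
    obtain ⟨u', hu'⟩ := dvd_of_dvd_sq_of_not_dvd_discr hp hd ⟨u, h1⟩
    choose v' hv' using fun j => (Nat.prime_iff_prime_int.1 hp).dvd_of_dvd_pow ⟨v j, h2 j⟩
    exact ⟨(u', v'), Prod.ext hu' (funext hv')⟩

lemma numOrdersOfIndex_le (hp : p.Prime) (hlarge : 2 * 5 ^ 5 ≤ p) (hd : ¬ (p : ℤ) ∣ discr K)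
    (i : ℕ) : numOrdersOfIndex K (p ^ i) ≤ (subringsOfIndex (Padded K) p i).ncard := by
  have : Finite (subringsOfIndex (Padded K) p i) :=
    finite_setOf_index_eq (goodPrime_padded hdeg hp hlarge hd) i
  rw [numOrdersOfIndex, ← Nat.card_coe_set_eq]
  refine Nat.card_le_card_of_injective (fun O => ⟨O.1.prod ⊤, ?_⟩) ?_
  · have h : (O.1.prod (⊤ : Subring (Fin (5 - Module.finrank ℚ K) → ℤ))).toAddSubgroup =
        O.1.toAddSubgroup.prod ⊤ := rfl
    change _ = _
    rw [h, AddSubgroup.index_prod, AddSubgroup.index_top, mul_one, O.2]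
  · rintro ⟨O, hO⟩ ⟨O', hO'⟩ h
    have h : O.prod (⊤ : Subring (Fin (5 - Module.finrank ℚ K) → ℤ)) = O'.prod ⊤ :=
      congrArg Subtype.val h
    refine Subtype.ext (SetLike.ext fun x => ?_)
    have := SetLike.ext_iff.1 h (x, 0)
    simpa [Subring.mem_prod] using this

end NumberField

section Summability

lemma exists_growth_bound : ∃ M : ℕ, ∀ p : ℕ, M ≤ p →
    (growth : ℝ) * (p : ℝ) ^ (-(9 / 220) : ℝ) ≤ 1 / 2 := by
  have h := ((tendsto_rpow_neg_atTop (y := 9 / 220) (by norm_num)).comp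
    tendsto_natCast_atTop_atTop).const_mul (growth : ℝ)
  rw [mul_zero] at h
  exact Filter.eventually_atTop.1 (h.eventually_le_const (by norm_num : (0 : ℝ) < 1 / 2))

lemma term_le {p i a : ℕ} {σ : ℝ} (hp : 0 < p) (hi : 2 ≤ i) (hσ : 19 / 20 < σ)
    (hgrowth : (growth : ℝ) * (p : ℝ) ^ (-(9 / 220) : ℝ) ≤ 1 / 2)
    (ha : (a : ℝ) ≤ (growth : ℝ) ^ i * (p : ℝ) ^ (max 0 (10 / 11 * (i : ℝ) - 1))) :
    (a : ℝ) * (p : ℝ) ^ (-(i : ℝ) * σ) ≤ (p : ℝ) ^ (-(1 + (σ - 19 / 20))) * (1 / 2 : ℝ) ^ i := by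
  have hp1 : (1 : ℝ) ≤ p := by exact_mod_cast hp
  have hp0 : (0 : ℝ) < p := by linarith
  have hi2 : (2 : ℝ) ≤ i := by exact_mod_cast hi
  rw [max_eq_right (by linarith)] at ha
  calc (a : ℝ) * (p : ℝ) ^ (-(i : ℝ) * σ)
      ≤ (growth : ℝ) ^ i * (p : ℝ) ^ (10 / 11 * (i : ℝ) - 1) * (p : ℝ) ^ (-(i : ℝ) * σ) := by
        gcongr
    _ = (growth : ℝ) ^ i * (p : ℝ) ^ (10 / 11 * (i : ℝ) - 1 + -(i : ℝ) * σ) := by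
        rw [Real.rpow_add hp0, mul_assoc]
    _ ≤ (growth : ℝ) ^ i * (p : ℝ) ^ (-(1 + (σ - 19 / 20)) + -(9 / 220) * (i : ℝ)) := by
        refine mul_le_mul_of_nonneg_left (Real.rpow_le_rpow_of_exponent_le hp1 ?_) (by positivity)
        nlinarith [mul_nonneg (sub_nonneg.2 hσ.le) (by linarith : (0 : ℝ) ≤ i - 1)]
    _ = (p : ℝ) ^ (-(1 + (σ - 19 / 20))) * ((growth : ℝ) * (p : ℝ) ^ (-(9 / 220) : ℝ)) ^ i := by
        rw [Real.rpow_add hp0, mul_pow, Real.rpow_mul hp0.le, Real.rpow_natCast]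
        ring
    _ ≤ _ := by gcongr

end Summability

end OrderCount

/-- For a number field `K` of degree at most 5 there is a finite set `S` of primes such
that for every real `σ > 19/20` the double series
`∑_{p ∉ S} ∑_{i ≥ 2} a^{1,<}_{𝓞 K}(p^i) p^{-iσ}` converges. -/
theorem stmt4 (K : Type*) [Field K] [NumberField K]
    (hdeg : Module.finrank ℚ K ≤ 5) :
    ∃ S : Finset ℕ, ∀ σ : ℝ, 19 / 20 < σ →
      Summable (fun x : {q : ℕ × ℕ // q.1.Prime ∧ q.1 ∉ S ∧ 2 ≤ q.2} =>
        (numOrdersOfIndex K (x.1.1 ^ x.1.2) : ℝ) * (x.1.1 : ℝ) ^ (-(x.1.2 : ℝ) * σ)) := by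
  obtain ⟨M, hM⟩ := OrderCount.exists_growth_bound
  refine ⟨Finset.range (max M (max (2 * 5 ^ 5) ((discr K).natAbs + 1))), fun σ hσ => ?_⟩
  have hsum : Summable fun q : ℕ × ℕ =>
      (q.1 : ℝ) ^ (-(1 + (σ - 19 / 20))) * (1 / 2 : ℝ) ^ q.2 :=
    Summable.mul_of_nonneg (Real.summable_nat_rpow.2 (by linarith))
      (summable_geometric_of_lt_one (by norm_num) (by norm_num))
      (fun n => by positivity) (fun n => by positivity)
  refine Summable.of_nonneg_of_le (fun x => by positivity) ?_
    (hsum.comp_injective Subtype.val_injective)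
  rintro ⟨⟨p, i⟩, hp, hS, hi⟩
  simp only at hp hS hi
  rw [Finset.mem_range, not_lt, max_le_iff, max_le_iff] at hS
  obtain ⟨hpM, hlarge, hdisc⟩ := hS
  have hd : ¬ (p : ℤ) ∣ discr K := fun h => by
    have := Nat.le_of_dvd (Int.natAbs_pos.2 (discr_ne_zero K)) (Int.natCast_dvd.1 h)
    omega
  refine OrderCount.term_le hp.pos hi hσ (hM p hpM) ?_
  exact (Nat.cast_le.2 (OrderCount.numOrdersOfIndex_le hdeg hp hlarge hd i)).trans
    (OrderCount.ncard_subringsOfIndex_le (OrderCount.goodPrime_padded hdeg hp hlarge hd) (by omega))
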